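/- arXiv:1207.1138 — 2 statements merged into one kernel-verified Lean document; each statement's English description precedes it below -/
import Mathlib

section
/- For any odd t such that p = 4t² + 1 is prime, the set of nonzero fourth powers {x⁴ : x ∈ F_p \ {0}} is a cyclic difference set DS(p, (p−1)/4, (p−5)/16) in Z_p. -/
open Finset

section QuadraticCharacterSums

variable {F : Type*} [Field F] [Fintype F] [DecidableEq F]

/-- The sum of the quadratic character over the values of a separable quadratic polynomial
that splits into linear factors. -/
theorem sum_quadraticChar_sub_mul_sub (hF : ringChar F ≠ 2) {a b : F} (hab : a ≠ b) :
    ∑ c : F, quadraticChar F ((a - c) * (b - c)) = -1 := by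
  have hba : b - a ≠ 0 := sub_ne_zero.2 hab.symm
  have hJ := jacobiSum_nontrivial_inv (quadraticChar_ne_one hF)
  rw [(quadraticChar_isQuadratic F).inv, jacobiSum] at hJ
  have hneg : quadraticChar F (-1) * quadraticChar F (-1) = 1 := by
    rw [← map_mul, neg_mul_neg, one_mul, map_one]
  rw [← ((Equiv.mulLeft₀ (b - a) hba).trans (Equiv.addLeft a)).sum_comp]
  calc _ = ∑ x : F, quadraticChar F (-1) * (quadraticChar F x * quadraticChar F (1 - x)) := by
        refine Finset.sum_congr rfl fun x _ ↦ ?_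
        simp only [Equiv.trans_apply, Equiv.mulLeft₀_apply, Equiv.coe_addLeft]
        rw [← map_mul, ← map_mul, show (a - (a + (b - a) * x)) * (b - (a + (b - a) * x))
          = (b - a) ^ 2 * (-1 * (x * (1 - x))) by ring, map_mul, quadraticChar_sq_one' hba,
          one_mul]
    _ = -1 := by rw [← Finset.mul_sum, hJ]; linarith

theorem sum_quadraticChar_sub_mul_self (a : F) :
    ∑ c : F, quadraticChar F ((a - c) * (a - c)) = Fintype.card F - 1 := by
  have h : ∀ c : F, quadraticChar F ((a - c) * (a - c)) = 1 - if a = c then 1 else 0 := by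
    intro c
    split_ifs with h
    · simp [h]
    · rw [← sq, quadraticChar_sq_one' (sub_ne_zero.2 h), sub_zero]
  simp [h]

/-- Summation over squares, weighted by the number of square roots. -/
theorem sum_comp_sq_eq (hF : ringChar F ≠ 2) (f : F → ℤ) :
    ∑ x : F, f (x ^ 2) = ∑ u : F, (quadraticChar F u + 1) * f u := by
  rw [← Finset.sum_fiberwise' univ (fun x : F ↦ x ^ 2) f]
  refine Finset.sum_congr rfl fun u _ ↦ ?_
  rw [Finset.sum_const, nsmul_eq_mul, ← quadraticChar_card_sqrts hF u]
  congr 3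
  ext x
  simp

theorem exists_eq_sq_or_eq_nonsquare_mul_sq {g : F} (hg : quadraticChar F g = -1) {c : F}
    (hc : c ≠ 0) : ∃ s : F, s ≠ 0 ∧ (c = s ^ 2 ∨ c = g * s ^ 2) := by
  have hg0 : g ≠ 0 := by rintro rfl; simp at hg
  have hsq : ∀ z : F, z ≠ 0 → quadraticChar F z = 1 → ∃ s : F, s ≠ 0 ∧ z = s ^ 2 := by
    intro z hz h
    obtain ⟨s, rfl⟩ := (quadraticChar_one_iff_isSquare hz).1 h
    exact ⟨s, by rintro rfl; simp at hz, (sq s).symm⟩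
  rcases quadraticChar_dichotomy hc with h | h
  · obtain ⟨s, hs, hcs⟩ := hsq c hc h
    exact ⟨s, hs, .inl hcs⟩
  · have hcg : quadraticChar F (c / g) = 1 := by
      have := map_mul (quadraticChar F) (c / g) g
      rw [div_mul_cancel₀ _ hg0, h, hg] at this
      linarith
    obtain ⟨s, hs, hcs⟩ := hsq _ (div_ne_zero hc hg0) hcg
    exact ⟨s, hs, .inr (by rw [← hcs, mul_div_cancel₀ _ hg0])⟩

/-- A function invariant under multiplication by nonzero squares is determined by its values
at `0`, at `1`, and at any nonsquare. -/
theorem two_mul_sum_of_mul_sq_invariant (hF : ringChar F ≠ 2) {g : F}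
    (hg : quadraticChar F g = -1) (f : F → ℤ) (hf : ∀ c s, s ≠ 0 → f (c * s ^ 2) = f c) :
    2 * ∑ c : F, f c = 2 * f 0 + (Fintype.card F - 1) * (f 1 + f g) := by
  have h : ∀ c : F, 2 * f c = (f 1 + f g) + quadraticChar F c * (f 1 - f g)
      + if c = 0 then 2 * f 0 - (f 1 + f g) else 0 := by
    intro c
    split_ifs with hc
    · subst hc; simp
    obtain ⟨s, hs, rfl | rfl⟩ := exists_eq_sq_or_eq_nonsquare_mul_sq hg hc
    · have := hf 1 s hs
      rw [one_mul] at this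
      rw [this, quadraticChar_sq_one' hs]
      ring
    · rw [hf g s hs, map_mul, quadraticChar_sq_one' hs, hg]
      ring
  rw [Finset.mul_sum, Finset.sum_congr rfl fun c _ ↦ h c, Finset.sum_add_distrib,
    Finset.sum_add_distrib, ← Finset.sum_mul, quadraticChar_sum_zero hF]
  simp
  ring

/-- The Jacobsthal sum `∑ u, η (u³ - c u)` of the quadratic character `η`. -/
def jacobsthalSum (c : F) : ℤ := ∑ u : F, quadraticChar F (u * (u ^ 2 - c))

theorem jacobsthalSum_mul_sq (c : F) {s : F} (hs : s ≠ 0) :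
    jacobsthalSum (c * s ^ 2) = quadraticChar F s * jacobsthalSum c := by
  unfold jacobsthalSum
  rw [← Equiv.sum_comp (Equiv.mulLeft₀ s hs), Finset.mul_sum]
  refine Finset.sum_congr rfl fun u _ ↦ ?_
  rw [Equiv.mulLeft₀_apply, show s * u * ((s * u) ^ 2 - c * s ^ 2)
    = s ^ 2 * (s * (u * (u ^ 2 - c))) by ring, map_mul, quadraticChar_sq_one' hs, one_mul, map_mul]

theorem jacobsthalSum_zero (hF : ringChar F ≠ 2) : jacobsthalSum (0 : F) = 0 := by
  rw [← quadraticChar_sum_zero hF]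
  refine Finset.sum_congr rfl fun u _ ↦ ?_
  rcases eq_or_ne u 0 with rfl | hu
  · simp
  · rw [map_mul, sub_zero, quadraticChar_sq_one' hu, mul_one]

theorem sum_jacobsthalSum_sq (hF : ringChar F ≠ 2) (hneg : quadraticChar F (-1) = 1) :
    ∑ c : F, jacobsthalSum c ^ 2 = 2 * Fintype.card F * (Fintype.card F - 1) := by
  have hquad : ∀ a b : F, ∑ c : F, quadraticChar F ((a - c) * (b - c))
      = Fintype.card F * (if a = b then 1 else 0) - 1 := by
    intro a b
    split_ifs with h
    · rw [h, sum_quadraticChar_sub_mul_self, mul_one]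
    · rw [sum_quadraticChar_sub_mul_sub hF h]; ring
  have hdiag : ∀ u : F, ∑ v : F, quadraticChar F u * quadraticChar F v *
      (if u ^ 2 = v ^ 2 then 1 else 0) = 2 - if u = 0 then 2 else 0 := by
    intro u
    split_ifs with hu
    · simp [hu]
    have hne : u ≠ -u := fun h ↦ hu (by
      have h2 : (2 : F) ≠ 0 := Ring.two_ne_zero hF
      have : 2 * u = 0 := by linear_combination h
      simpa [h2] using this)
    have hset : (univ.filter fun v : F ↦ u ^ 2 = v ^ 2) = {u, -u} := by
      ext v
      simp only [mem_filter, mem_univ, true_and, mem_insert, mem_singleton]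
      rw [eq_comm, sq_eq_sq_iff_eq_or_eq_neg]
    simp only [mul_ite, mul_one, mul_zero]
    rw [← Finset.sum_filter, hset, Finset.sum_pair hne, ← map_mul, ← map_mul,
      show u * -u = -1 * u ^ 2 by ring, ← sq, map_mul, hneg, quadraticChar_sq_one' hu]
    norm_num
  calc ∑ c : F, jacobsthalSum c ^ 2
      = ∑ u : F, ∑ v : F, quadraticChar F u * quadraticChar F v *
          ∑ c : F, quadraticChar F ((u ^ 2 - c) * (v ^ 2 - c)) := by
        simp only [jacobsthalSum, sq (Finset.sum _ _), Finset.sum_mul_sum]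
        simp only [Finset.mul_sum]
        rw [Finset.sum_comm]
        refine Finset.sum_congr rfl fun u _ ↦ ?_
        rw [Finset.sum_comm]
        refine Finset.sum_congr rfl fun v _ ↦ Finset.sum_congr rfl fun c _ ↦ ?_
        simp only [map_mul]
        ring
    _ = Fintype.card F * ∑ u : F, ∑ v : F, quadraticChar F u * quadraticChar F v *
          (if u ^ 2 = v ^ 2 then 1 else 0)
        - (∑ u : F, quadraticChar F u) * ∑ v : F, quadraticChar F v := by
        rw [Finset.sum_mul_sum, Finset.mul_sum, ← Finset.sum_sub_distrib]
        refine Finset.sum_congr rfl fun u _ ↦ ?_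
        rw [Finset.mul_sum, ← Finset.sum_sub_distrib]
        refine Finset.sum_congr rfl fun v _ ↦ ?_
        rw [hquad]
        ring
    _ = _ := by
        rw [quadraticChar_sum_zero hF, Finset.sum_congr rfl fun u _ ↦ hdiag u]
        simp
        ring

/-- The identity of Jacobsthal, writing `card F` as a sum of two squares. -/
theorem jacobsthalSum_one_sq_add_sq (hF : ringChar F ≠ 2) (hneg : quadraticChar F (-1) = 1)
    {g : F} (hg : quadraticChar F g = -1) :
    jacobsthalSum (1 : F) ^ 2 + jacobsthalSum g ^ 2 = 4 * Fintype.card F := by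
  have h := two_mul_sum_of_mul_sq_invariant hF hg (fun c ↦ jacobsthalSum c ^ 2) fun c s hs ↦ by
    rw [jacobsthalSum_mul_sq c hs, mul_pow, quadraticChar_sq_one hs, one_mul]
  simp only [sum_jacobsthalSum_sq hF hneg, jacobsthalSum_zero hF] at h
  have hq : (Fintype.card F : ℤ) - 1 ≠ 0 := by
    have := Fintype.one_lt_card (α := F)
    lia
  apply mul_left_cancel₀ hq
  linear_combination -h

theorem sum_quadraticChar_pow_four_sub_one (hF : ringChar F ≠ 2) :
    ∑ x : F, quadraticChar F (x ^ 4 - 1) = jacobsthalSum (1 : F) - 1 := by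
  have h11 : (1 : F) ≠ -1 := (Ring.neg_one_ne_one_of_char_ne_two hF).symm
  have h := sum_comp_sq_eq hF fun u : F ↦ quadraticChar F (u ^ 2 - 1)
  simp only [← pow_mul, Nat.reduceMul] at h
  have hq := sum_quadraticChar_sub_mul_sub hF h11
  rw [h, sub_eq_add_neg, ← hq, jacobsthalSum, ← Finset.sum_add_distrib]
  refine Finset.sum_congr rfl fun u _ ↦ ?_
  rw [show (1 - u) * (-1 - u) = u ^ 2 - 1 by ring, map_mul]
  ring


/-- The nonzero fourth powers of a finite field. -/
def fourthPowers (F : Type*) [Field F] [Fintype F] [DecidableEq F] : Finset F :=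
  (univ.filter fun x : F ↦ x ≠ 0).image fun x ↦ x ^ 4

theorem mem_fourthPowers {a : F} : a ∈ fourthPowers F ↔ ∃ x : F, x ≠ 0 ∧ x ^ 4 = a := by
  simp [fourthPowers]

theorem ne_zero_of_mem_fourthPowers {a : F} (ha : a ∈ fourthPowers F) : a ≠ 0 := by
  obtain ⟨x, hx, rfl⟩ := mem_fourthPowers.1 ha
  exact pow_ne_zero 4 hx

theorem one_mem_fourthPowers : (1 : F) ∈ fourthPowers F :=
  mem_fourthPowers.2 ⟨1, one_ne_zero, one_pow 4⟩

theorem mul_mem_fourthPowers_iff {a b : F} (hb : b ∈ fourthPowers F) :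
    b * a ∈ fourthPowers F ↔ a ∈ fourthPowers F := by
  obtain ⟨y, hy, rfl⟩ := mem_fourthPowers.1 hb
  simp only [mem_fourthPowers]
  constructor
  · rintro ⟨x, hx, h⟩
    refine ⟨x / y, div_ne_zero hx hy, ?_⟩
    rw [div_pow, h, mul_div_cancel_left₀ _ (pow_ne_zero 4 hy)]
  · rintro ⟨x, hx, rfl⟩
    exact ⟨y * x, mul_ne_zero hy hx, mul_pow y x 4⟩

theorem sum_pow_four_eq (hF : ringChar F ≠ 2) {i : F} (hi : i ^ 2 = -1) (f : F → ℤ) :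
    ∑ x : F, f (x ^ 4) = f 0 + 4 * ∑ a ∈ fourthPowers F, f a := by
  have h2 : (2 : F) ≠ 0 := Ring.two_ne_zero hF
  have hfib : ∀ a ∈ fourthPowers F,
      ∑ x ∈ univ.filter (fun x : F ↦ x ≠ 0) with x ^ 4 = a, f a = 4 * f a := by
    intro a ha
    obtain ⟨y, hy, rfl⟩ := mem_fourthPowers.1 ha
    have hset : ((univ.filter fun x : F ↦ x ≠ 0).filter fun x ↦ x ^ 4 = y ^ 4)
        = {y, -y, i * y, -(i * y)} := by
      ext x
      simp only [mem_filter, mem_univ, true_and, mem_insert, mem_singleton]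
      constructor
      · rintro ⟨-, h⟩
        have : (x - y) * ((x + y) * ((x - i * y) * (x + i * y))) = 0 := by
          linear_combination h - (x ^ 2 - y ^ 2) * y ^ 2 * hi
        rcases mul_eq_zero.1 this with h | h
        · exact .inl (sub_eq_zero.1 h)
        rcases mul_eq_zero.1 h with h | h
        · exact .inr (.inl (eq_neg_of_add_eq_zero_left h))
        rcases mul_eq_zero.1 h with h | h
        · exact .inr (.inr (.inl (sub_eq_zero.1 h)))
        · exact .inr (.inr (.inr (eq_neg_of_add_eq_zero_left h)))
      · have hi0 : i ≠ 0 := by rintro rfl; simp at hi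
        have hi4 : i ^ 4 = 1 := by linear_combination (i ^ 2 - 1) * hi
        rintro (rfl | rfl | rfl | rfl)
        · exact ⟨hy, rfl⟩
        · exact ⟨neg_ne_zero.2 hy, by ring⟩
        · exact ⟨mul_ne_zero hi0 hy, by linear_combination y ^ 4 * hi4⟩
        · exact ⟨neg_ne_zero.2 (mul_ne_zero hi0 hy), by linear_combination y ^ 4 * hi4⟩
    have hcard : ({y, -y, i * y, -(i * y)} : Finset F).card = 4 := by
      have hi0 : i ≠ 0 := by rintro rfl; simp at hi
      have hself : ∀ z : F, z ≠ 0 → z ≠ -z := fun z hz h ↦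
        mul_ne_zero h2 hz (by linear_combination h)
      have hsq : ∀ z w : F, z ^ 2 = y ^ 2 → w ^ 2 = -y ^ 2 → z ≠ w := by
        rintro z _ hz hw rfl
        exact mul_ne_zero h2 (pow_ne_zero 2 hy) (by linear_combination hw - hz)
      have h1 : (i * y) ^ 2 = -y ^ 2 := by linear_combination y ^ 2 * hi
      have h3 : (-(i * y)) ^ 2 = -y ^ 2 := by linear_combination y ^ 2 * hi
      rw [card_insert_of_notMem, card_insert_of_notMem, card_pair (hself _ (mul_ne_zero hi0 hy))]
      · simp only [mem_insert, mem_singleton, not_or]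
        exact ⟨hsq _ _ (neg_sq y) h1, hsq _ _ (neg_sq y) h3⟩
      · simp only [mem_insert, mem_singleton, not_or]
        exact ⟨hself y hy, hsq _ _ rfl h1, hsq _ _ rfl h3⟩
    rw [hset, Finset.sum_const, hcard, nsmul_eq_mul, Nat.cast_ofNat]
  rw [Finset.mul_sum, ← Finset.sum_congr rfl hfib,
    fourthPowers,
    Finset.sum_fiberwise_of_maps_to' (fun x hx ↦ mem_image_of_mem (fun x : F ↦ x ^ 4) hx) f,
    Finset.filter_ne' univ (0 : F)]
  rw [← Finset.add_sum_erase univ (fun x : F ↦ f (x ^ 4)) (mem_univ 0)]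
  simp

theorem card_fourthPowers (hF : ringChar F ≠ 2) {i : F} (hi : i ^ 2 = -1) :
    (Fintype.card F : ℤ) = 1 + 4 * (fourthPowers F).card := by
  simpa using sum_pow_four_eq hF hi fun _ ↦ 1

/-- If `-1` is the square of a nonsquare, then every nonzero square is a fourth power
up to sign. -/
theorem sq_or_neg_sq_mem_fourthPowers {i : F} (hi : i ^ 2 = -1)
    (hη : quadraticChar F i = -1) {s : F} (hs : s ≠ 0) :
    s ^ 2 ∈ fourthPowers F ∨ -s ^ 2 ∈ fourthPowers F := by
  have hsq : ∀ z : F, z ≠ 0 → quadraticChar F z = 1 → z ^ 2 ∈ fourthPowers F := by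
    intro z hz h
    obtain ⟨w, rfl⟩ := (quadraticChar_one_iff_isSquare hz).1 h
    exact mem_fourthPowers.2 ⟨w, by rintro rfl; simp at hz, by ring⟩
  rcases quadraticChar_dichotomy hs with h | h
  · exact .inl (hsq s hs h)
  · have hi0 : i ≠ 0 := by rintro rfl; simp at hi
    have := hsq (i * s) (mul_ne_zero hi0 hs) (by rw [map_mul, hη, h]; norm_num)
    rw [mul_pow, hi, neg_one_mul] at this
    exact .inr this

theorem four_mul_sum_quadraticChar_fourthPowers_sub_one (hF : ringChar F ≠ 2) {i : F}
    (hi : i ^ 2 = -1) (hneg : quadraticChar F (-1) = 1) :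
    4 * ∑ a ∈ fourthPowers F, quadraticChar F (a - 1) = jacobsthalSum (1 : F) - 2 := by
  have h := sum_pow_four_eq hF hi fun a ↦ quadraticChar F (a - 1)
  rw [sum_quadraticChar_pow_four_sub_one hF, zero_sub, hneg] at h
  linarith

theorem even_sum_quadraticChar_fourthPowers_sub_one (hodd : Odd (fourthPowers F).card) :
    Even (∑ a ∈ fourthPowers F, quadraticChar F (a - 1)) := by
  rw [← Finset.add_sum_erase _ _ one_mem_fourthPowers, sub_self, MulChar.map_zero, zero_add]
  have h : Even (∑ a ∈ (fourthPowers F).erase 1, (quadraticChar F (a - 1) - 1)) := by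
    refine Finset.even_sum _ fun a ha ↦ ?_
    rcases quadraticChar_dichotomy (sub_ne_zero.2 (Finset.ne_of_mem_erase ha)) with h | h <;>
      simp [h]
  rw [Finset.sum_sub_distrib, Int.even_sub] at h
  refine h.2 ?_
  rw [Finset.sum_const, card_erase_of_mem one_mem_fourthPowers, nsmul_eq_mul, mul_one,
    Int.even_coe_nat]
  exact hodd.tsub_odd odd_one

/-- The number of representations of `d` as a difference of two nonzero fourth powers. -/
def fourthPowerDiffCount (d : F) : ℕ :=
  ((fourthPowers F ×ˢ fourthPowers F).filter fun q ↦ q.1 - q.2 = d).card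

theorem fourthPowerDiffCount_neg (d : F) :
    fourthPowerDiffCount (-d) = fourthPowerDiffCount d := by
  refine Finset.card_equiv (Equiv.prodComm F F) fun q ↦ ?_
  simp only [mem_filter, mem_product, Equiv.prodComm_apply, Prod.fst_swap, Prod.snd_swap]
  rw [and_comm (a := q.1 ∈ _), ← neg_sub q.2, neg_inj]

theorem fourthPowerDiffCount_mul {b : F} (hb : b ∈ fourthPowers F) (d : F) :
    fourthPowerDiffCount (b * d) = fourthPowerDiffCount d := by
  have hb0 := ne_zero_of_mem_fourthPowers hb
  symm
  refine Finset.card_equiv ((Equiv.mulLeft₀ b hb0).prodCongr (Equiv.mulLeft₀ b hb0)) fun q ↦ ?_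
  simp [mul_mem_fourthPowers_iff hb, ← mul_sub, hb0]

theorem fourthPowerDiffCount_mul_sq {i : F} (hi : i ^ 2 = -1) (hη : quadraticChar F i = -1)
    (d : F) {s : F} (hs : s ≠ 0) :
    fourthPowerDiffCount (d * s ^ 2) = fourthPowerDiffCount d := by
  rcases sq_or_neg_sq_mem_fourthPowers hi hη hs with h | h
  · rw [mul_comm, fourthPowerDiffCount_mul h]
  · rw [← fourthPowerDiffCount_neg, ← mul_neg, mul_comm, fourthPowerDiffCount_mul h]

theorem fourthPowerDiffCount_zero :
    fourthPowerDiffCount (0 : F) = (fourthPowers F).card := by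
  have : ((fourthPowers F ×ˢ fourthPowers F).filter fun q ↦ q.1 - q.2 = 0)
      = (fourthPowers F).diag := by
    ext ⟨a, b⟩
    simp only [mem_filter, mem_product, mem_diag, sub_eq_zero]
    constructor
    · rintro ⟨⟨h, -⟩, h'⟩; exact ⟨h, h'⟩
    · rintro ⟨h, rfl⟩; exact ⟨⟨h, h⟩, rfl⟩
  rw [fourthPowerDiffCount, this, diag_card]

theorem sum_fourthPowerDiffCount_mul (f : F → ℤ) :
    ∑ d : F, f d * fourthPowerDiffCount d
      = ∑ a ∈ fourthPowers F, ∑ b ∈ fourthPowers F, f (a - b) := by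
  rw [← Finset.sum_product', ← Finset.sum_fiberwise' _ (fun q : F × F ↦ q.1 - q.2) f]
  refine Finset.sum_congr rfl fun d _ ↦ ?_
  rw [Finset.sum_const, nsmul_eq_mul, mul_comm, fourthPowerDiffCount]

/-- If the quadratic character sums to zero over the fourth powers shifted by one, then all
nonzero elements are equally often differences of fourth powers. -/
theorem sub_one_mul_fourthPowerDiffCount (hF : ringChar F ≠ 2) {i : F} (hi : i ^ 2 = -1)
    (hη : quadraticChar F i = -1)
    (hsum : ∑ a ∈ fourthPowers F, quadraticChar F (a - 1) = 0) {d : F} (hd : d ≠ 0) :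
    ((Fintype.card F : ℤ) - 1) * fourthPowerDiffCount d
      = (fourthPowers F).card * ((fourthPowers F).card - 1) := by
  have hq : (Fintype.card F : ℤ) - 1 ≠ 0 := by
    have := Fintype.one_lt_card (α := F)
    lia
  have hinv (c s : F) (hs : s ≠ 0) := fourthPowerDiffCount_mul_sq hi hη c hs
  have h1 := two_mul_sum_of_mul_sq_invariant hF hη (fun c ↦ (fourthPowerDiffCount c : ℤ))
    fun c s hs ↦ by rw [hinv c s hs]
  have h2 := two_mul_sum_of_mul_sq_invariant hF hη
    (fun c ↦ quadraticChar F c * (fourthPowerDiffCount c : ℤ))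
    fun c s hs ↦ by rw [hinv c s hs, map_mul, quadraticChar_sq_one' hs, mul_one]
  have h3 := sum_fourthPowerDiffCount_mul fun _ : F ↦ 1
  simp only [one_mul, Finset.sum_const, nsmul_eq_mul, mul_one] at h3
  have h4 : ∑ c : F, quadraticChar F c * (fourthPowerDiffCount c : ℤ) = 0 := by
    rw [sum_fourthPowerDiffCount_mul, Finset.sum_comm]
    refine Finset.sum_eq_zero fun b hb ↦ ?_
    have hb0 := ne_zero_of_mem_fourthPowers hb
    rw [← mul_zero (quadraticChar F b), ← hsum, Finset.mul_sum]
    symm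
    refine Finset.sum_equiv (Equiv.mulLeft₀ b hb0)
      (fun a ↦ (mul_mem_fourthPowers_iff hb).symm) fun a _ ↦ ?_
    rw [← map_mul, mul_sub, mul_one, Equiv.mulLeft₀_apply]
  rw [h3, fourthPowerDiffCount_zero] at h1
  rw [h4, MulChar.map_zero, map_one, hη] at h2
  have h5 : (fourthPowerDiffCount (1 : F) : ℤ) = fourthPowerDiffCount i := by
    apply mul_left_cancel₀ hq
    linear_combination -h2
  have h6 : fourthPowerDiffCount d = fourthPowerDiffCount (1 : F) := by
    obtain ⟨s, hs, rfl | rfl⟩ := exists_eq_sq_or_eq_nonsquare_mul_sq hη hd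
    · rw [← hinv 1 s hs, one_mul]
    · rw [hinv i s hs]
      exact_mod_cast h5.symm
  rw [h6]
  rw [← h5] at h1
  linarith

end QuadraticCharacterSums

/-- Uniqueness of the representation of a prime as `1 + c²`. -/
theorem sq_eq_one_of_prime_eq_sq_add_sq {p a b c : ℤ} (hp : Prime p) (hpos : 0 < p)
    (hc : p = 1 + c ^ 2) (hab : p = a ^ 2 + b ^ 2) (ha : Odd a) (hb : Even b) : a ^ 2 = 1 := by
  have hdvd : p ∣ (a * c - b) * (a * c + b) :=
    ⟨a ^ 2 - 1, by linear_combination a ^ 2 * (-hc) + hab⟩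
  have key : ∀ b : ℤ, p = a ^ 2 + b ^ 2 → Even b → p ∣ a * c - b → a ^ 2 = 1 := by
    rintro b hab hb ⟨m, hm⟩
    have hsum : (a + b * c) ^ 2 + (p * m) ^ 2 = p ^ 2 := by
      rw [← hm, sq p]; nth_rewrite 1 [hc]; rw [hab]; ring
    have hm1 : m ^ 2 ≤ 1 := by
      have : p ^ 2 * m ^ 2 ≤ p ^ 2 * 1 := by nlinarith [sq_nonneg (a + b * c)]
      exact le_of_mul_le_mul_left this (by positivity)
    have hm0 : m = 0 := by
      by_contra hne
      have hmsq : m ^ 2 = 1 := le_antisymm hm1 (by have := sq_nonneg m; have := pow_ne_zero 2 hne; lia)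
      have h0 : (a + b * c) ^ 2 = 0 := by
        rw [mul_pow, hmsq] at hsum; linarith
      have hbc : a = -(b * c) := by have := pow_eq_zero_iff two_ne_zero |>.1 h0; linarith
      have : Even a := by rw [hbc]; exact (hb.mul_right c).neg
      exact Int.not_even_iff_odd.2 ha this
    have hb' : b = a * c := by rw [hm0] at hm; linarith
    have : p * (a ^ 2 - 1) = 0 := by
      rw [hb'] at hab
      linear_combination a ^ 2 * hc - hab
    rcases mul_eq_zero.1 this with h | h
    · exact absurd h hpos.ne'
    · linarith
  rcases hp.dvd_or_dvd hdvd with h | h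
  · exact key b hab hb h
  · exact key (-b) (by rw [neg_sq]; exact hab) hb.neg (by rwa [sub_neg_eq_add])

/-- For odd `t` with `p = 4t² + 1` prime, the nonzero fourth powers form a
cyclic difference set `DS(p, (p−1)/4, (p−5)/16)` in `ℤ/pℤ`. -/
theorem biquadratic_residues_difference_set (t p : ℕ) (ht : Odd t)
    (hp : p = 4 * t ^ 2 + 1) [Fact p.Prime] :
    let B : Finset (ZMod p) :=
      (Finset.univ.filter (fun x : ZMod p => x ≠ 0)).image (fun x => x ^ 4)
    B.card = (p - 1) / 4 ∧
    ∀ d : ZMod p, d ≠ 0 →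
      ((B ×ˢ B).filter (fun q => q.1 ≠ q.2 ∧ q.1 - q.2 = d)).card = (p - 5) / 16 := by
  have hprime : p.Prime := Fact.out
  have hcardF : Fintype.card (ZMod p) = p := ZMod.card p
  have ht2 : t ^ 2 % 8 = 1 := by
    obtain ⟨k, rfl⟩ := ht
    obtain ⟨m, hm⟩ := Nat.even_mul_succ_self k
    have : (2 * k + 1) ^ 2 = 4 * (k * (k + 1)) + 1 := by ring
    lia
  have hF : ringChar (ZMod p) ≠ 2 := by
    rw [ZMod.ringChar_zmod_n]; lia
  obtain ⟨i, hi⟩ : ∃ i : ZMod p, i ^ 2 = -1 := by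
    obtain ⟨i, hi⟩ := ZMod.exists_sq_eq_neg_one_iff (p := p).2 (by lia)
    exact ⟨i, by rw [sq, hi]⟩
  have hi0 : i ≠ 0 := by rintro rfl; simp at hi
  have hη : quadraticChar (ZMod p) i = -1 := by
    rw [quadraticChar_eq_pow_of_char_ne_two hF hi0, if_neg]
    have hexp : Fintype.card (ZMod p) / 2 = 2 * t ^ 2 := by lia
    rw [hexp, pow_mul, hi, ht.pow.neg_one_pow]
    exact Ring.neg_one_ne_one_of_char_ne_two hF
  have hneg : quadraticChar (ZMod p) (-1) = 1 := by
    rw [← hi, quadraticChar_sq_one' hi0]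
  have hcard := card_fourthPowers hF hi
  rw [hcardF] at hcard
  have hBt : (fourthPowers (ZMod p)).card = t ^ 2 := by lia
  have hsum : ∑ a ∈ fourthPowers (ZMod p), quadraticChar (ZMod p) (a - 1) = 0 := by
    have hJ := four_mul_sum_quadraticChar_fourthPowers_sub_one hF hi hneg
    have hS := even_sum_quadraticChar_fourthPowers_sub_one (F := ZMod p) (hBt ▸ ht.pow)
    set S := ∑ a ∈ fourthPowers (ZMod p), quadraticChar (ZMod p) (a - 1)
    have hpZ : (p : ℤ) = 1 + (2 * (t : ℤ)) ^ 2 := by rw [hp]; push_cast; ring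
    have hid := jacobsthalSum_one_sq_add_sq hF hneg hη
    rw [hcardF, show jacobsthalSum (1 : ZMod p) = 2 * (1 + 2 * S) by linarith] at hid
    have hev : Even (jacobsthalSum i) := by
      have : Even (jacobsthalSum i ^ 2) :=
        ⟨2 * p - 2 * (1 + 2 * S) ^ 2, by linear_combination hid⟩
      exact (Int.even_pow.1 this).1
    obtain ⟨b, hb⟩ := hev
    rw [hb] at hid
    have hab : (p : ℤ) = (1 + 2 * S) ^ 2 + b ^ 2 := by
      linarith
    have hodd : Odd (1 + 2 * S) := ⟨S, by ring⟩
    have hbe : Even b := by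
      have : Even (b ^ 2) := by
        refine ⟨2 * (t : ℤ) ^ 2 - 2 * S - 2 * S ^ 2, by linear_combination hpZ - hab⟩
      exact (Int.even_pow.1 this).1
    have h1 := sq_eq_one_of_prime_eq_sq_add_sq (Nat.prime_iff_prime_int.1 hprime)
      (by exact_mod_cast hprime.pos) hpZ hab hodd hbe
    obtain ⟨m, hm⟩ := hS
    rcases sq_eq_one_iff.1 h1 with h | h <;> lia
  refine ⟨?_, fun d hd ↦ ?_⟩
  · change (fourthPowers (ZMod p)).card = _
    lia
  · have hN := sub_one_mul_fourthPowerDiffCount hF hi hη hsum hd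
    have hfilter : ((fourthPowers (ZMod p) ×ˢ fourthPowers (ZMod p)).filter
        fun q ↦ q.1 ≠ q.2 ∧ q.1 - q.2 = d).card = fourthPowerDiffCount d := by
      rw [fourthPowerDiffCount]
      congr 1
      refine Finset.filter_congr fun q _ ↦ and_iff_right_of_imp ?_
      rintro h h'
      exact hd (by rw [← h, h', sub_self])
    change ((fourthPowers (ZMod p) ×ˢ fourthPowers (ZMod p)).filter
        fun q ↦ q.1 ≠ q.2 ∧ q.1 - q.2 = d).card = _
    rw [hfilter]
    have hpt : (p : ℤ) - 1 = 4 * (t : ℤ) ^ 2 := by rw [hp]; push_cast; ring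
    rw [hcardF, hBt, hpt] at hN
    have ht0 : (t : ℤ) ^ 2 ≠ 0 := by
      have : t ^ 2 ≠ 0 := by lia
      exact_mod_cast this
    push_cast at hN
    have h4 : 4 * (fourthPowerDiffCount d : ℤ) = (t : ℤ) ^ 2 - 1 := by
      apply mul_left_cancel₀ ht0
      linear_combination hN
    have h5 : 4 * fourthPowerDiffCount d + 1 = t ^ 2 := by
      zify
      linarith
    lia
end

section
/- For any odd integers t and u such that p = 8t² + 1 = 64u² + 9 is prime, the set of nonzero eighth powers {x⁸ : x ∈ F_p \ {0}} is a cyclic difference set DS(p, (p−1)/8, (p−9)/64) in Z_p. -/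
section

open Finset

/-- The substitution `x ↦ x / (x - 1)` in a Jacobi sum. -/
lemma jacobiSum_eq_apply_neg_one_mul_jacobiSum_inv {F R : Type*} [Field F] [Fintype F]
    [CommRing R] (α β : MulChar F R) :
    jacobiSum α β = α (-1) * jacobiSum α (α * β)⁻¹ := by
  classical
  rw [jacobiSum_eq_sum_sdiff, jacobiSum_eq_sum_sdiff, mul_sum]
  refine sum_nbij' (fun x ↦ x / (x - 1)) (fun x ↦ x / (x - 1)) ?_ ?_ ?_ ?_ ?_
  · intro x hx
    simp only [mem_sdiff, mem_univ, mem_insert, mem_singleton, true_and, not_or] at hx ⊢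
    have h1 : x - 1 ≠ 0 := sub_ne_zero.2 hx.2
    refine ⟨div_ne_zero hx.1 h1, fun h ↦ ?_⟩
    rw [div_eq_one_iff_eq h1] at h
    exact one_ne_zero (sub_eq_self.1 h.symm)
  · intro x hx
    simp only [mem_sdiff, mem_univ, mem_insert, mem_singleton, true_and, not_or] at hx ⊢
    have h1 : x - 1 ≠ 0 := sub_ne_zero.2 hx.2
    refine ⟨div_ne_zero hx.1 h1, fun h ↦ ?_⟩
    rw [div_eq_one_iff_eq h1] at h
    exact one_ne_zero (sub_eq_self.1 h.symm)
  · intro x hx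
    simp only [mem_sdiff, mem_univ, mem_insert, mem_singleton, true_and, not_or] at hx
    have h1 : x - 1 ≠ 0 := sub_ne_zero.2 hx.2
    have : x / (x - 1) - 1 = 1 / (x - 1) := by field_simp; ring
    rw [this]; field_simp
  · intro x hx
    simp only [mem_sdiff, mem_univ, mem_insert, mem_singleton, true_and, not_or] at hx
    have h1 : x - 1 ≠ 0 := sub_ne_zero.2 hx.2
    have : x / (x - 1) - 1 = 1 / (x - 1) := by field_simp; ring
    rw [this]; field_simp
  · intro x hx
    simp only [mem_sdiff, mem_univ, mem_insert, mem_singleton, true_and, not_or] at hx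
    have h1 : x - 1 ≠ 0 := sub_ne_zero.2 hx.2
    have h2 : (1 - x / (x - 1))⁻¹ = 1 - x := by
      have : 1 - x / (x - 1) = -1 / (x - 1) := by field_simp; ring
      rw [this, inv_div, div_neg, div_one]; ring
    rw [MulChar.inv_apply', h2, MulChar.mul_apply, ← mul_assoc, ← mul_assoc, ← map_mul, ← map_mul]
    congr 2
    field_simp
    ring

section

variable {F : Type*} [Field F] [Fintype F] [DecidableEq F]

lemma sum_apply_sq_eq_sum_quadraticChar {R : Type*} [CommRing R] (hF : ringChar F ≠ 2)
    (f : F → R) : ∑ y, f (y ^ 2) = ∑ z, ((quadraticChar F z : ℤ) + 1 : R) * f z := by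
  rw [← sum_fiberwise univ (fun y : F ↦ y ^ 2) (fun y ↦ f (y ^ 2))]
  refine sum_congr rfl fun z _ ↦ ?_
  have h := quadraticChar_card_sqrts hF z
  rw [sum_congr rfl (g := fun _ ↦ f z) (by intro y hy; simp at hy; rw [hy]), sum_const,
    nsmul_eq_mul]
  congr 1
  have h2 : ({x : F | x ^ 2 = z} : Set F).toFinset = univ.filter (fun y : F ↦ y ^ 2 = z) := by
    ext; simp
  rw [h2] at h
  exact_mod_cast congrArg (Int.cast : ℤ → R) h

/-- The character of order two with values in `R`. -/
noncomputable abbrev quadraticMulChar (F R : Type*) [Field F] [Fintype F] [DecidableEq F]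
    [CommRing R] : MulChar F R :=
  (quadraticChar F).ringHomComp (Int.castRingHom R)

lemma apply_four_mul_jacobiSum_self {R : Type*} [CommRing R] [IsDomain R] (hF : ringChar F ≠ 2)
    {ψ : MulChar F R} (hψ : ψ ≠ 1) :
    ψ 4 * jacobiSum ψ ψ = jacobiSum ψ (quadraticMulChar F R) := by
  have h2 : (2 : F) ≠ 0 := Ring.two_ne_zero hF
  have h0 : ∑ z : F, ψ (1 - z) = 0 := by
    rw [← MulChar.sum_eq_zero_of_ne_one hψ]
    exact (Equiv.subLeft (1 : F)).sum_comp (fun z ↦ ψ z)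
  have h1 := sum_apply_sq_eq_sum_quadraticChar hF (fun z ↦ ψ (1 - z))
  simp only [add_mul, one_mul, sum_add_distrib, h0, add_zero] at h1
  rw [jacobiSum_comm ψ (quadraticMulChar F R), jacobiSum, jacobiSum, mul_sum]
  simp only [MulChar.ringHomComp_apply, eq_intCast]
  rw [← h1, ← ((Equiv.mulLeft₀ (2 : F) h2).trans (Equiv.subRight 1)).sum_comp
    (fun y ↦ ψ (1 - y ^ 2))]
  refine sum_congr rfl fun x _ ↦ ?_
  rw [← map_mul, ← map_mul]
  congr 1
  simp
  ring

/-- The Hasse–Davenport product formula for the quadratic character, as an identity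
between Jacobi sums. -/
lemma apply_four_mul_jacobiSum_mul_quadraticMulChar {K : Type*} [Field K] (hF : ringChar F ≠ 2)
    (hK : (Fintype.card F : K) ≠ 0) {e : AddChar F K} (he : e.IsPrimitive)
    {ψ : MulChar F K} (h1 : ψ ^ 2 ≠ 1) (h2 : ψ ^ 2 * quadraticMulChar F K ≠ 1)
    (h3 : ψ * quadraticMulChar F K ≠ 1) :
    ψ 4 * jacobiSum ψ (ψ * quadraticMulChar F K) = jacobiSum (ψ ^ 2) (quadraticMulChar F K) := by
  have h0 : ψ ≠ 1 := by rintro rfl; simp at h1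
  have e1 := jacobiSum_mul_nontrivial (χ := ψ) (φ := ψ) (by rwa [← sq]) e
  have e2 := jacobiSum_mul_nontrivial (χ := ψ) h3 e
  have e3 := jacobiSum_mul_nontrivial (χ := ψ) (φ := ψ * quadraticMulChar F K)
    (by rwa [← mul_assoc, ← sq]) e
  have e4 := jacobiSum_mul_nontrivial h2 e
  have e5 := apply_four_mul_jacobiSum_self hF h0
  rw [← mul_assoc, ← sq] at e3
  rw [← sq] at e1
  apply mul_left_cancel₀ (gaussSum_ne_zero_of_nontrivial hK h2 he)
  apply mul_left_cancel₀ (gaussSum_ne_zero_of_nontrivial hK h0 he)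
  rw [← e5] at e2
  linear_combination ψ 4 * gaussSum ψ e * e3 - gaussSum ψ e * e4 -
    ψ 4 * gaussSum (ψ * quadraticMulChar F K) e * e1 + gaussSum (ψ ^ 2) e * e2

/-- A congruence modulo four obtained by pairing `x` with `x⁻¹`. -/
lemma sum_mul_quadraticChar_modEq (hF : ringChar F ≠ 2) (hneg : quadraticChar F (-1) = 1)
    {e : F → ℤ} (h0 : e 0 = 0) (h1 : e 1 ^ 2 = 1) (hm : e (-1) ^ 2 = 1)
    (hinv : ∀ x, e x⁻¹ = e x) (he : ∀ x, e x = -1 ∨ e x = 0 ∨ e x = 1)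
    (hsq : ∀ x, e x ≠ 0 → quadraticChar F x = 1) :
    ∑ x, e x * quadraticChar F (1 - x) ≡
      e (-1) * quadraticChar F 2 + (∑ x, e x ^ 2) - 2 [ZMOD 4] := by
  have hne : (-1 : F) ≠ 1 := Ring.neg_one_ne_one_of_char_ne_two hF
  have key : ∑ x ∈ univ \ {1, -1}, ((e x * quadraticChar F (1 - x) - e x ^ 2 : ℤ) : ZMod 4)
      = 0 := by
    refine sum_involution (fun x _ ↦ x⁻¹) ?_ ?_ ?_ ?_
    · intro x hx
      simp only [mem_sdiff, mem_univ, mem_insert, mem_singleton, true_and, not_or] at hx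
      rcases eq_or_ne (e x) 0 with hx0 | hx0
      · simp [hinv, hx0]
      have hx1 : x ≠ 0 := by rintro rfl; exact hx0 h0
      have hq : quadraticChar F (1 - x⁻¹) = quadraticChar F (1 - x) := by
        have h : 1 - x = x * (-1) * (1 - x⁻¹) := by field_simp; ring
        rw [h, map_mul, map_mul, hneg, hsq x hx0, one_mul, one_mul]
      rw [hinv, hq, ← Int.cast_add, ZMod.intCast_zmod_eq_zero_iff_dvd]
      rcases quadraticChar_dichotomy (sub_ne_zero.2 (Ne.symm hx.1)) with h | h <;>
        rcases he x with h' | h' | h' <;> rw [h, h'] <;> norm_num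
    · intro x hx hne0 heq
      simp only [mem_sdiff, mem_univ, mem_insert, mem_singleton, true_and, not_or] at hx
      rcases eq_or_ne x 0 with rfl | hx0
      · simp [h0] at hne0
      · have h : x * x = 1 := by
          nth_rewrite 2 [← heq]
          exact mul_inv_cancel₀ hx0
        exact (mul_self_eq_one_iff.1 h).elim hx.1 hx.2
    · intro x hx
      simp only [mem_sdiff, mem_univ, mem_insert, mem_singleton, true_and, not_or] at hx ⊢
      exact ⟨fun h ↦ hx.1 (by simpa using h), fun h ↦ hx.2 (by
        rw [inv_eq_iff_eq_inv] at h
        rw [h]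
        norm_num)⟩
    · intro x _
      exact inv_inv x
  have e1 := sum_sdiff_eq_sub (f := fun x ↦ e x * quadraticChar F (1 - x) - e x ^ 2)
    (subset_univ ({1, -1} : Finset F))
  rw [← Int.cast_sum, ZMod.intCast_zmod_eq_zero_iff_dvd, e1, sum_pair hne.symm,
    sum_sub_distrib, h1, hm] at key
  simp only [sub_self, sub_neg_eq_add, one_add_one_eq_two] at key
  refine (Int.modEq_iff_dvd.2 ?_).symm
  convert key using 1
  · rfl
  · rw [MulChar.map_zero]
    ring

lemma exists_jacobiSum_quadratic_of_sq_eq (hF : ringChar F ≠ 2) {m : ℤ}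
    (hm : (Fintype.card F : ℤ) = 8 * m + 1) {χ : MulChar F ℂ} (hχ : χ ^ 2 = quadraticMulChar F ℂ)
    (hneg : χ (-1) = 1) (h2 : quadraticChar F 2 = 1) :
    ∃ a b : ℤ, jacobiSum χ (quadraticMulChar F ℂ) + jacobiSum (χ ^ 3) (quadraticMulChar F ℂ)
      = 2 * a ∧ a ^ 2 + b ^ 2 = Fintype.card F ∧ a ≡ -1 [ZMOD 4] := by
  have hφ1 : quadraticMulChar F ℂ ≠ 1 :=
    (MulChar.ringHomComp_ne_one_iff (Int.castRingHom ℂ).injective_int).2 (quadraticChar_ne_one hF)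
  have hφ2 : quadraticMulChar F ℂ ^ 2 = 1 :=
    ((quadraticChar_isQuadratic F).comp _).sq_eq_one
  have hχ4 : χ ^ 4 = 1 := by rw [← hφ2, ← hχ, ← pow_mul]
  have hφχ (x : F) : ((quadraticChar F x : ℤ) : ℂ) = χ x ^ 2 := by
    rw [← χ.pow_apply' two_ne_zero, hχ]; rfl
  have hpow (x : F) (hx : x ≠ 0) : χ x ^ 4 = 1 := by
    rw [← χ.pow_apply' four_ne_zero, hχ4, MulChar.one_apply hx.isUnit]
  have hex (x : F) : ∃ e f : ℤ, χ x + χ x ^ 3 = 2 * e ∧ χ x - χ x ^ 3 = 2 * Complex.I * f ∧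
      χ x ^ 4 + χ x ^ 2 = 2 * (e ^ 2 : ℤ) ∧ (e = -1 ∨ e = 0 ∨ e = 1) ∧
      (e ≠ 0 → χ x ^ 2 = 1) := by
    rcases eq_or_ne x 0 with rfl | hx
    · exact ⟨0, 0, by simp [MulChar.map_zero]⟩
    have h := hpow x hx
    have h' : (χ x - 1) * ((χ x + 1) * ((χ x - Complex.I) * (χ x + Complex.I))) = 0 := by
      linear_combination h - (χ x ^ 2 - 1) * Complex.I_sq
    have hI3 : Complex.I ^ 3 = - Complex.I := by rw [pow_succ, Complex.I_sq]; ring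
    simp only [mul_eq_zero, sub_eq_zero, add_eq_zero_iff_eq_neg] at h'
    rcases h' with h' | h' | h' | h'
    · exact ⟨1, 0, by rw [h']; norm_num⟩
    · exact ⟨-1, 0, by rw [h']; norm_num⟩
    · exact ⟨0, 1, by rw [h']; norm_num [hI3]; ring⟩
    · exact ⟨0, -1, by rw [h']; norm_num [hI3, Odd.neg_pow (show Odd 3 by decide)]; ring⟩
  choose e f he hf he2 he3 hsq using hex
  have hχ1 : χ ≠ 1 := by rintro rfl; exact hφ1 (by rw [← hχ, one_pow])
  have hχφ : χ * quadraticMulChar F ℂ ≠ 1 := by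
    intro h
    rw [← hχ, ← pow_succ'] at h
    exact hχ1 (by rw [← hχ4, pow_succ, h, one_mul])
  have hprod := jacobiSum_mul_jacobiSum_inv (F := F) (F' := ℂ)
    (by rw [ringChar.eq_zero]; exact (CharP.ringChar_ne_zero_of_finite F).symm) hχ1 hφ1 hχφ
  rw [inv_eq_of_mul_eq_one_right (b := χ ^ 3) (by rw [← pow_succ', hχ4]),
    ((quadraticChar_isQuadratic F).comp _).inv] at hprod
  have hadd : jacobiSum χ (quadraticMulChar F ℂ) + jacobiSum (χ ^ 3) (quadraticMulChar F ℂ)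
      = 2 * (∑ x, e x * quadraticChar F (1 - x) : ℤ) := by
    rw [jacobiSum, jacobiSum, ← sum_add_distrib]
    push_cast
    rw [mul_sum]
    refine sum_congr rfl fun x _ ↦ ?_
    rw [χ.pow_apply' three_ne_zero, MulChar.ringHomComp_apply, eq_intCast]
    linear_combination (quadraticChar F (1 - x) : ℂ) * he x
  have hsub : jacobiSum χ (quadraticMulChar F ℂ) - jacobiSum (χ ^ 3) (quadraticMulChar F ℂ)
      = 2 * Complex.I * (∑ x, f x * quadraticChar F (1 - x) : ℤ) := by
    rw [jacobiSum, jacobiSum, ← sum_sub_distrib]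
    push_cast
    rw [mul_sum]
    refine sum_congr rfl fun x _ ↦ ?_
    rw [χ.pow_apply' three_ne_zero, MulChar.ringHomComp_apply, eq_intCast]
    linear_combination (quadraticChar F (1 - x) : ℂ) * hf x
  have hsum : ∑ x, e x ^ 2 = 4 * m := by
    have h1 : ∑ x, (χ ^ 4) x = (Fintype.card F - 1 : ℤ) := by
      rw [hχ4, MulChar.sum_one_eq_card_units, Fintype.card_units,
        Nat.cast_sub Fintype.card_pos]
      simp
    have h2 : ∑ x, (χ ^ 2) x = 0 := MulChar.sum_eq_zero_of_ne_one (hχ ▸ hφ1)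
    have h3 : (2 * ∑ x, e x ^ 2 : ℤ) = Fintype.card F - 1 := by
      have : ((2 * ∑ x, e x ^ 2 : ℤ) : ℂ) = (Fintype.card F - 1 : ℤ) := by
        rw [← h1, ← add_zero (∑ x, (χ ^ 4) x), ← h2, ← sum_add_distrib, Int.cast_mul, Int.cast_sum,
          mul_sum]
        refine sum_congr rfl fun x _ ↦ ?_
        rw [χ.pow_apply' four_ne_zero, χ.pow_apply' two_ne_zero, he2]
        norm_num
      exact_mod_cast this
    linarith
  have hval (x : F) (hx : χ x = 1) : e x = 1 := by
    have := he x
    rw [hx] at this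
    norm_num at this
    exact_mod_cast this
  refine ⟨_, ∑ x, f x * quadraticChar F (1 - x), hadd, ?_, ?_⟩
  · have : ((((∑ x, e x * quadraticChar F (1 - x)) ^ 2 + (∑ x, f x * quadraticChar F (1 - x)) ^ 2
        : ℤ)) : ℂ) = ((Fintype.card F : ℤ) : ℂ) := by
      rw [Int.cast_add, Int.cast_pow, Int.cast_pow, Int.cast_natCast, ← hprod]
      linear_combination - (1 / 4 : ℂ) * (jacobiSum χ (quadraticMulChar F ℂ) +
        jacobiSum (χ ^ 3) (quadraticMulChar F ℂ) +
        2 * (∑ x, e x * quadraticChar F (1 - x) : ℤ)) * hadd + (1 / 4 : ℂ) *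
        (jacobiSum χ (quadraticMulChar F ℂ) - jacobiSum (χ ^ 3) (quadraticMulChar F ℂ) +
        2 * Complex.I * (∑ x, f x * quadraticChar F (1 - x) : ℤ)) * hsub +
        (∑ x, f x * quadraticChar F (1 - x) : ℤ) ^ 2 * Complex.I_sq
    exact_mod_cast this
  · have h := sum_mul_quadraticChar_modEq hF (e := e)
      (by have := hφχ (-1); rw [hneg] at this; norm_num at this; exact_mod_cast this)
      (by simpa [MulChar.map_zero] using he 0) (by rw [hval 1 (map_one χ), one_pow])
      (by rw [hval _ hneg, one_pow]) ?_ he3 ?_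
    · rw [hval _ hneg, h2, hsum] at h
      exact h.trans ((Int.modEq_iff_dvd.2 ⟨-m, by ring⟩))
    · intro x
      rcases eq_or_ne x 0 with rfl | hx
      · simp
      have : (2 : ℂ) * e x⁻¹ = 2 * e x := by
        have h0 : χ x ≠ 0 := by intro h; simpa [h] using hpow x hx
        rw [← he, ← he, ← MulChar.inv_apply', MulChar.inv_apply_eq_inv']
        field_simp
        linear_combination (-1 - χ x ^ 2) * hpow x hx
      exact_mod_cast mul_left_cancel₀ two_ne_zero this
    · intro x hx
      have := hφχ x
      rw [hsq x hx] at this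
      exact_mod_cast this

lemma jacobiSum_pow_three_quadratic {R : Type*} [CommRing R] {ψ : MulChar F R}
    (hψ : ψ ^ 4 = quadraticMulChar F R) (hneg : ψ (-1) = -1) :
    jacobiSum (ψ ^ 3) (quadraticMulChar F R) = jacobiSum ψ (quadraticMulChar F R) := by
  have h8 : ψ ^ 8 = 1 := by
    rw [← ((quadraticChar_isQuadratic F).comp (Int.castRingHom R)).sq_eq_one]
    change ψ ^ 8 = quadraticMulChar F R ^ 2
    rw [← hψ, ← pow_mul]
  rw [jacobiSum_eq_apply_neg_one_mul_jacobiSum_inv,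
    jacobiSum_eq_apply_neg_one_mul_jacobiSum_inv ψ, ← hψ, ← pow_add, ← pow_succ',
    inv_eq_of_mul_eq_one_right (b := ψ) (by rw [← pow_succ, h8]),
    inv_eq_of_mul_eq_one_right (b := ψ ^ 3) (by rw [← pow_add, h8]), jacobiSum_comm,
    ψ.pow_apply' three_ne_zero, hneg]
  norm_num

lemma exists_jacobiSum_quadratic_of_pow_four_eq (hF : ringChar F ≠ 2) {m : ℤ} (hmodd : Odd m)
    (hm : (Fintype.card F : ℤ) = 8 * m + 1) {ψ : MulChar F ℂ} (hψ : ψ ^ 4 = quadraticMulChar F ℂ)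
    (hneg : ψ (-1) = -1) (h2 : quadraticChar F 2 = 1) :
    ∃ c d : ℤ, jacobiSum ψ (quadraticMulChar F ℂ) + jacobiSum (ψ ^ 5) (quadraticMulChar F ℂ)
      = 2 * c ∧ c ^ 2 + 2 * d ^ 2 = Fintype.card F ∧ c ≡ -1 [ZMOD 4] := by
  have hφ1 : quadraticMulChar F ℂ ≠ 1 :=
    (MulChar.ringHomComp_ne_one_iff (Int.castRingHom ℂ).injective_int).2 (quadraticChar_ne_one hF)
  have hφ2 : quadraticMulChar F ℂ ^ 2 = 1 :=
    ((quadraticChar_isQuadratic F).comp _).sq_eq_one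
  have hψ8 : ψ ^ 8 = 1 := by rw [← hφ2, ← hψ, ← pow_mul]
  have hψφ (x : F) : ((quadraticChar F x : ℤ) : ℂ) = ψ x ^ 4 := by
    rw [← ψ.pow_apply' four_ne_zero, hψ]; rfl
  have hpow (x : F) (hx : x ≠ 0) : ψ x ^ 8 = 1 := by
    rw [← ψ.pow_apply' (by norm_num), hψ8, MulChar.one_apply hx.isUnit]
  obtain ⟨ζ, hζ⟩ : ∃ ζ : ℂ, IsPrimitiveRoot ζ 8 := ⟨_, Complex.isPrimitiveRoot_exp 8 (by norm_num)⟩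
  have hζ4 : ζ ^ 4 = -1 := by
    have h := hζ.pow_eq_one
    have h' := hζ.pow_ne_one_of_pos_of_lt (l := 4) (by norm_num) (by norm_num)
    rw [show 8 = 4 * 2 by norm_num, pow_mul, sq, mul_self_eq_one_iff] at h
    exact h.resolve_left h'
  have hex (x : F) : ∃ e f : ℤ, ψ x + ψ x ^ 3 + ψ x ^ 5 + ψ x ^ 7 = 4 * e ∧
      ψ x + ψ x ^ 3 - ψ x ^ 5 - ψ x ^ 7 = 2 * (ζ + ζ ^ 3) * f ∧
      ψ x ^ 2 + ψ x ^ 4 + ψ x ^ 6 + ψ x ^ 8 = 4 * (e ^ 2 : ℤ) ∧ (e = -1 ∨ e = 0 ∨ e = 1) ∧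
      (e ≠ 0 → ψ x ^ 4 = 1) := by
    rcases eq_or_ne x 0 with rfl | hx
    · exact ⟨0, 0, by simp [MulChar.map_zero]⟩
    obtain ⟨k, hk, h⟩ := MulChar.exists_apply_eq_pow hψ8 hζ hx
    rw [h]
    interval_cases k
    · exact ⟨1, 0, by norm_num⟩
    · exact ⟨0, 1, by push_cast; grind⟩
    · exact ⟨0, 0, by push_cast; grind⟩
    · exact ⟨0, 1, by push_cast; grind⟩
    · exact ⟨-1, 0, by push_cast; grind⟩
    · exact ⟨0, -1, by push_cast; grind⟩
    · exact ⟨0, 0, by push_cast; grind⟩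
    · exact ⟨0, -1, by push_cast; grind⟩
  choose e f he hf he2 he3 hsq using hex
  have hψne {k : ℕ} (hk : quadraticMulChar F ℂ ∈ Submonoid.powers (ψ ^ k)) : ψ ^ k ≠ 1 := by
    intro h
    obtain ⟨n, hn⟩ := hk
    exact hφ1 (by rw [← hn, h]; exact one_pow n)
  have hψ1 : ψ ≠ 1 := by simpa using hψne (k := 1) ⟨4, by simpa using hψ⟩
  have hψ54 : (ψ ^ 5) ^ 4 = quadraticMulChar F ℂ := by
    rw [← pow_mul, ← hψ, show 5 * 4 = 8 * 2 + 4 by norm_num, pow_add, pow_mul, hψ8, one_pow,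
      one_mul]
  have hψ5 : ψ * quadraticMulChar F ℂ ≠ 1 := by
    rw [← hψ, ← pow_succ']
    exact hψne ⟨4, hψ54⟩
  have hprod := jacobiSum_mul_jacobiSum_inv (F := F) (F' := ℂ)
    (by rw [ringChar.eq_zero]; exact (CharP.ringChar_ne_zero_of_finite F).symm) hψ1 hφ1 hψ5
  have hψ3 := jacobiSum_pow_three_quadratic hψ hneg
  have hψ7 := jacobiSum_pow_three_quadratic (ψ := ψ ^ 5)
    hψ54
    (by rw [ψ.pow_apply' (by norm_num), hneg]; norm_num)
  rw [← pow_mul, show 5 * 3 = 8 + 7 by norm_num, pow_add, hψ8, one_mul] at hψ7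
  rw [inv_eq_of_mul_eq_one_right (b := ψ ^ 7) (by rw [← pow_succ', hψ8]),
    ((quadraticChar_isQuadratic F).comp _).inv, hψ7] at hprod
  have hadd : jacobiSum ψ (quadraticMulChar F ℂ) + jacobiSum (ψ ^ 5) (quadraticMulChar F ℂ)
      = 2 * (∑ x, e x * quadraticChar F (1 - x) : ℤ) := by
    have h : jacobiSum ψ (quadraticMulChar F ℂ) + jacobiSum (ψ ^ 3) (quadraticMulChar F ℂ) +
        jacobiSum (ψ ^ 5) (quadraticMulChar F ℂ) + jacobiSum (ψ ^ 7) (quadraticMulChar F ℂ)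
        = 4 * (∑ x, e x * quadraticChar F (1 - x) : ℤ) := by
      simp only [jacobiSum, ← sum_add_distrib]
      push_cast
      rw [mul_sum]
      refine sum_congr rfl fun x _ ↦ ?_
      rw [ψ.pow_apply' three_ne_zero, ψ.pow_apply' (by norm_num), ψ.pow_apply' (by norm_num),
        MulChar.ringHomComp_apply, eq_intCast]
      linear_combination (quadraticChar F (1 - x) : ℂ) * he x
    rw [hψ3, hψ7] at h
    linear_combination h / 2
  have hsub : jacobiSum ψ (quadraticMulChar F ℂ) - jacobiSum (ψ ^ 5) (quadraticMulChar F ℂ)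
      = (ζ + ζ ^ 3) * (∑ x, f x * quadraticChar F (1 - x) : ℤ) := by
    have h : jacobiSum ψ (quadraticMulChar F ℂ) + jacobiSum (ψ ^ 3) (quadraticMulChar F ℂ) -
        jacobiSum (ψ ^ 5) (quadraticMulChar F ℂ) - jacobiSum (ψ ^ 7) (quadraticMulChar F ℂ)
        = 2 * (ζ + ζ ^ 3) * (∑ x, f x * quadraticChar F (1 - x) : ℤ) := by
      simp only [jacobiSum, ← sum_add_distrib, ← sum_sub_distrib]
      push_cast
      rw [mul_sum]
      refine sum_congr rfl fun x _ ↦ ?_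
      rw [ψ.pow_apply' three_ne_zero, ψ.pow_apply' (by norm_num), ψ.pow_apply' (by norm_num),
        MulChar.ringHomComp_apply, eq_intCast]
      linear_combination (quadraticChar F (1 - x) : ℂ) * hf x
    rw [hψ3, hψ7] at h
    linear_combination h / 2
  have hsum : ∑ x, e x ^ 2 = 2 * m := by
    have h1 : ∑ x, (ψ ^ 8) x = (Fintype.card F - 1 : ℤ) := by
      rw [hψ8, MulChar.sum_one_eq_card_units, Fintype.card_units,
        Nat.cast_sub Fintype.card_pos]
      simp
    have h2 : ∑ x, (ψ ^ 2) x = 0 := MulChar.sum_eq_zero_of_ne_one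
      (hψne ⟨2, by rw [← hψ]; change (ψ ^ 2) ^ 2 = _; rw [← pow_mul]⟩)
    have h4 : ∑ x, (ψ ^ 4) x = 0 := MulChar.sum_eq_zero_of_ne_one (hψ ▸ hφ1)
    have h6 : ∑ x, (ψ ^ 6) x = 0 := MulChar.sum_eq_zero_of_ne_one
      (hψne ⟨2, by rw [← hψ]; change (ψ ^ 6) ^ 2 = _; rw [← pow_mul,
        show 6 * 2 = 8 + 4 by norm_num, pow_add, hψ8, one_mul]⟩)
    have h3 : (4 * ∑ x, e x ^ 2 : ℤ) = Fintype.card F - 1 := by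
      have : ((4 * ∑ x, e x ^ 2 : ℤ) : ℂ) = (Fintype.card F - 1 : ℤ) := by
        have h : ∑ x, ((ψ ^ 2) x + (ψ ^ 4) x + (ψ ^ 6) x + (ψ ^ 8) x) =
            (Fintype.card F - 1 : ℤ) := by
          rw [sum_add_distrib, sum_add_distrib, sum_add_distrib, h1, h2, h4, h6]
          simp
        rw [← h, Int.cast_mul, Int.cast_sum, mul_sum]
        refine sum_congr rfl fun x _ ↦ ?_
        rw [ψ.pow_apply' four_ne_zero, ψ.pow_apply' two_ne_zero, ψ.pow_apply' (by norm_num),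
          ψ.pow_apply' (by norm_num), he2]
        norm_num
      exact_mod_cast this
    linarith
  have hsq' : 2 * (∑ x, e x * quadraticChar F (1 - x)) ^ 2 +
      (∑ x, f x * quadraticChar F (1 - x)) ^ 2 = 2 * (Fintype.card F : ℤ) := by
    have : ((2 * (∑ x, e x * quadraticChar F (1 - x)) ^ 2 +
        (∑ x, f x * quadraticChar F (1 - x)) ^ 2 : ℤ) : ℂ) = (2 * (Fintype.card F : ℤ) : ℤ) := by
      rw [Int.cast_add, Int.cast_mul, Int.cast_pow, Int.cast_pow, Int.cast_mul, Int.cast_natCast,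
        ← hprod]
      generalize (∑ x, e x * quadraticChar F (1 - x)) = C at *
      generalize (∑ x, f x * quadraticChar F (1 - x)) = D at *
      push_cast at *
      have hs : (ζ + ζ ^ 3) ^ 2 = -2 := by linear_combination (ζ ^ 2 + 2) * hζ4
      linear_combination (-1 / 2 : ℂ) * (jacobiSum ψ (quadraticMulChar F ℂ) +
        jacobiSum (ψ ^ 5) (quadraticMulChar F ℂ) + 2 * C) * hadd + (1 / 2 : ℂ) *
        (jacobiSum ψ (quadraticMulChar F ℂ) - jacobiSum (ψ ^ 5) (quadraticMulChar F ℂ) +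
        (ζ + ζ ^ 3) * D) * hsub + (D ^ 2 / 2 : ℂ) * hs
    exact_mod_cast this
  obtain ⟨d, hd⟩ : Even (∑ x, f x * quadraticChar F (1 - x)) := by
    have : Even ((∑ x, f x * quadraticChar F (1 - x)) ^ 2) :=
      ⟨Fintype.card F - (∑ x, e x * quadraticChar F (1 - x)) ^ 2, by linarith⟩
    exact (Int.even_pow.1 this).1
  refine ⟨_, d, hadd, ?_, ?_⟩
  · rw [hd] at hsq'
    linarith
  · have hval1 : e 1 = 1 := by
      have := he 1
      rw [map_one] at this
      norm_num at this
      exact_mod_cast this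
    have hvalneg : e (-1) = -1 := by
      have := he (-1)
      rw [hneg] at this
      norm_num [Odd.neg_one_pow (show Odd 3 by decide), Odd.neg_one_pow (show Odd 5 by decide),
        Odd.neg_one_pow (show Odd 7 by decide)] at this
      have h : (-4 : ℤ) = 4 * e (-1) := by exact_mod_cast this
      linarith
    have h := sum_mul_quadraticChar_modEq hF (e := e)
      (by have := hψφ (-1); rw [hneg] at this; norm_num at this; exact_mod_cast this)
      (by simpa [MulChar.map_zero] using he 0) (by rw [hval1, one_pow])
      (by rw [hvalneg]; norm_num) ?_ he3 ?_
    · rw [hvalneg, h2, hsum] at h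
      obtain ⟨k, rfl⟩ := hmodd
      exact h.trans ((Int.modEq_iff_dvd.2 ⟨-k, by ring⟩))
    · intro x
      rcases eq_or_ne x 0 with rfl | hx
      · simp
      have : (4 : ℂ) * e x⁻¹ = 4 * e x := by
        have h0 : ψ x ≠ 0 := by intro h; simpa [h] using hpow x hx
        have h7 : (ψ x)⁻¹ = ψ x ^ 7 := inv_eq_of_mul_eq_one_right (by rw [← pow_succ', hpow x hx])
        rw [← he, ← he, ← MulChar.inv_apply', MulChar.inv_apply_eq_inv', h7]
        have h8 := hpow x hx
        generalize ψ x = v at *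
        grind
      have h : 4 * e x⁻¹ = 4 * e x := by exact_mod_cast this
      linarith
    · intro x hx
      have := hψφ x
      rw [hsq x hx] at this
      exact_mod_cast this

end

lemma exists_sq_eq_and_dvd_mul_sub_mul {p : ℕ} (hp : p.Prime) {n x y z w : ℤ}
    (h1 : x ^ 2 + n * y ^ 2 = p) (h2 : z ^ 2 + n * w ^ 2 = p) :
    ∃ v : ℤ, v ^ 2 = w ^ 2 ∧ (p : ℤ) ∣ x * v - z * y := by
  have h : (p : ℤ) ∣ (x * w - z * y) * (x * (-w) - z * y) :=
    ⟨y ^ 2 - w ^ 2, by linear_combination -w ^ 2 * h1 + y ^ 2 * h2⟩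
  rcases (Nat.prime_iff_prime_int.1 hp).dvd_or_dvd h with h | h
  · exact ⟨w, rfl, h⟩
  · exact ⟨-w, neg_sq w, h⟩

/-- The representation of a prime in the form `x ^ 2 + 2 * y ^ 2` is unique up to signs. -/
lemma sq_eq_sq_of_sq_add_two_mul_sq_eq_prime {p : ℕ} (hp : p.Prime) {x y z w : ℤ}
    (h1 : x ^ 2 + 2 * y ^ 2 = p) (h2 : z ^ 2 + 2 * w ^ 2 = p) : x ^ 2 = z ^ 2 := by
  obtain ⟨v, hv, m, hm⟩ := exists_sq_eq_and_dvd_mul_sub_mul hp h1 h2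
  rw [← hv] at h2
  have hp0 : (0 : ℤ) < p := by exact_mod_cast hp.pos
  have h3 : (p : ℤ) ^ 2 = (x * z + 2 * y * v) ^ 2 + 2 * (p * m) ^ 2 := by
    rw [← hm, sq (p : ℤ)]
    nth_rewrite 1 [← h1]
    rw [← h2]
    ring
  have hm0 : m = 0 := by
    by_contra h
    have : 0 < m ^ 2 := by positivity
    have : (p : ℤ) ^ 2 ≤ (p * m) ^ 2 := by rw [mul_pow]; nlinarith [sq_nonneg (p : ℤ)]
    nlinarith [sq_nonneg (x * z + 2 * y * v), pow_pos hp0 2]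
  have h4 : x * v = z * y := by rw [hm0] at hm; linarith
  apply mul_left_cancel₀ hp0.ne'
  linear_combination -x ^ 2 * h2 + z ^ 2 * h1 + 2 * (x * v + z * y) * h4

/-- The odd part of the representation of an odd prime as a sum of two squares is unique up to
sign. -/
lemma sq_eq_sq_of_sq_add_sq_eq_prime {p : ℕ} (hp : p.Prime) {x y z w : ℤ} (hx : Odd x)
    (hz : Odd z) (hp2 : Odd p) (h1 : x ^ 2 + y ^ 2 = p) (h2 : z ^ 2 + w ^ 2 = p) :
    x ^ 2 = z ^ 2 := by
  obtain ⟨v, hv, m, hm⟩ := exists_sq_eq_and_dvd_mul_sub_mul (n := 1) hp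
    (by rw [one_mul, h1]) (by rw [one_mul, h2])
  rw [← hv] at h2
  have hp0 : (0 : ℤ) < p := by exact_mod_cast hp.pos
  have hp2' : Odd (p : ℤ) := by exact_mod_cast hp2
  have hy : Even y := by
    have : Even (y ^ 2) := by
      rw [show y ^ 2 = p - x ^ 2 by linarith]; exact hp2'.sub_odd hx.pow
    exact (Int.even_pow.1 this).1
  have hv' : Even v := by
    have : Even (v ^ 2) := by
      rw [show v ^ 2 = p - z ^ 2 by linarith]; exact hp2'.sub_odd hz.pow
    exact (Int.even_pow.1 this).1
  have hmeven : Even m := by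
    have : Even (p * m) := hm ▸ (hv'.mul_left x).sub (hy.mul_left z)
    exact (Int.even_mul.1 this).resolve_left (Int.not_even_iff_odd.2 hp2')
  have h3 : (p : ℤ) ^ 2 = (x * z + y * v) ^ 2 + (p * m) ^ 2 := by
    rw [← hm, sq (p : ℤ)]
    nth_rewrite 1 [← h1]
    rw [← h2]
    ring
  have hm0 : m = 0 := by
    obtain ⟨k, rfl⟩ := hmeven
    by_contra h
    have hk : k ≠ 0 := by rintro rfl; simp at h
    have : 0 < k ^ 2 := by positivity
    have : (p : ℤ) ^ 2 ≤ (p * k) ^ 2 := by rw [mul_pow]; nlinarith [sq_nonneg (p : ℤ)]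
    nlinarith [sq_nonneg (x * z + y * v), pow_pos hp0 2]
  have h4 : x * v = z * y := by rw [hm0] at hm; linarith
  apply mul_left_cancel₀ hp0.ne'
  linear_combination -x ^ 2 * h2 + z ^ 2 * h1 + (x * v + z * y) * h4

lemma sum_apply_add_mul_apply {F R : Type*} [Field F] [Fintype F] [CommRing R]
    (α β : MulChar F R) {d : F} (hd : d ≠ 0) :
    ∑ b, α (b + d) * β b = (α * β) d * β (-1) * jacobiSum β α := by
  rw [jacobiSum, mul_sum, ← Equiv.sum_comp (Equiv.mulLeft₀ (-d) (neg_ne_zero.2 hd))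
    (fun b ↦ α (b + d) * β b)]
  refine sum_congr rfl fun y _ ↦ ?_
  have h1 : -d * y + d = d * (1 - y) := by ring
  have h2 : -d * y = d * (-1) * y := by ring
  change α (-d * y + d) * β (-d * y) = _
  rw [h1, h2, MulChar.mul_apply]
  simp only [map_mul]
  ring

lemma sum_range_pow_apply {F R : Type*} [Field F] [CommRing R] [IsDomain R]
    {ψ : MulChar F R} {n : ℕ} (hψ : ψ ^ n = 1) [DecidableEq R] (x : F) :
    ∑ k ∈ range n, (ψ ^ k) x = if ψ x = 1 then (n : R) else 0 := by
  rcases eq_or_ne x 0 with rfl | hx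
  · simp [MulChar.map_zero]
  have h (k : ℕ) : (ψ ^ k) x = ψ x ^ k := MulChar.pow_apply_coe ψ k (Units.mk0 x hx)
  simp only [h]
  split_ifs with h1
  · simp [h1]
  · have : ψ x ^ n = 1 := by rw [← h, hψ, MulChar.one_apply hx.isUnit]
    apply mul_left_cancel₀ (sub_ne_zero.2 h1)
    rw [mul_geom_sum, this, sub_self, mul_zero]

lemma quadraticChar_eq_one_of_eq_eight_mul_sq_add_one {p m : ℕ} [Fact p.Prime] (hm : Odd m)
    (hp : p = 8 * m ^ 2 + 1) : quadraticChar (ZMod p) m = 1 := by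
  have h1 : p % 4 = 1 := by omega
  have h := jacobiSym.quadratic_reciprocity_one_mod_four h1 hm
  have h2 : jacobiSym p m = jacobiSym 1 m := by
    refine jacobiSym.mod_left' ?_
    have : (p : ℤ) = 1 + m * (8 * m) := by rw [hp]; push_cast; ring
    rw [this, Int.add_mul_emod_self_left]
  rw [h2, jacobiSym.one_left, ← jacobiSym.legendreSym.to_jacobiSym, legendreSym,
    Int.cast_natCast] at h
  exact h.symm

lemma exists_mulChar_pow_four_eq_quadratic (F : Type*) [Field F] [Fintype F] [DecidableEq F]
    {n : ℕ} (hn : Odd n) (hcard : Fintype.card F = 8 * n + 1) :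
    ∃ ψ : MulChar F ℂ, orderOf ψ = 8 ∧ ψ ^ 4 = quadraticMulChar F ℂ ∧ ψ (-1) = -1 ∧
      ∀ x, ψ x = 1 → ∃ y, y ≠ 0 ∧ y ^ 8 = x := by
  have hF : ringChar F ≠ 2 := by
    intro h
    have := FiniteField.even_card_of_char_two h
    omega
  obtain ⟨ψ, hψ⟩ := MulChar.exists_mulChar_orderOf F (n := 8) (by rw [hcard]; simp)
    (Complex.isPrimitiveRoot_exp 8 (by norm_num))
  obtain ⟨g, hg⟩ := IsCyclic.exists_generator (α := Fˣ)
  have hψ8 : ψ ^ 8 = 1 := hψ ▸ pow_orderOf_eq_one ψ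
  have hψ4 : ψ ^ 4 ≠ 1 := pow_ne_one_of_lt_orderOf (by norm_num) (by rw [hψ]; norm_num)
  have hg8 : ψ g ^ 8 = 1 := by rw [← ψ.pow_apply_coe, hψ8, MulChar.one_apply_coe]
  have hg4 : ψ g ^ 4 = -1 := by
    rw [show 8 = 4 * 2 by norm_num, pow_mul, sq, mul_self_eq_one_iff] at hg8
    refine hg8.resolve_left fun h ↦ hψ4 ?_
    rw [MulChar.eq_iff hg, ψ.pow_apply_coe, h, MulChar.one_apply_coe]
  have hφg : quadraticChar F g = -1 := by
    refine (quadraticChar_dichotomy g.ne_zero).resolve_left fun h ↦ quadraticChar_ne_one hF ?_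
    rw [MulChar.eq_iff hg, h, MulChar.one_apply_coe]
  have hordg : orderOf g = 8 * n := by
    rw [orderOf_eq_card_of_forall_mem_zpowers hg, Nat.card_eq_fintype_card, Fintype.card_units,
      hcard, Nat.add_sub_cancel]
  have hn0 := hn.pos
  have hgn : (g : F) ^ (4 * n) = -1 := by
    have h1 : (g : F) ^ (4 * n) * (g : F) ^ (4 * n) = 1 := by
      rw [← pow_add, ← Units.val_pow_eq_pow_val, show 4 * n + 4 * n = orderOf g by omega,
        pow_orderOf_eq_one, Units.val_one]
    refine (mul_self_eq_one_iff.1 h1).resolve_left fun h ↦ ?_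
    have h2 : g ^ (4 * n) = 1 := Units.ext (by rw [Units.val_pow_eq_pow_val, h, Units.val_one])
    exact pow_ne_one_of_lt_orderOf (by omega) (by omega) h2
  have hordψ : orderOf (ψ g) = 8 :=
    orderOf_eq_prime_pow (p := 2) (n := 2) (by norm_num [hg4]) (by norm_num [hg8])
  refine ⟨ψ, hψ, ?_, ?_, fun x hx ↦ ?_⟩
  · rw [MulChar.eq_iff hg, ψ.pow_apply_coe, hg4, MulChar.ringHomComp_apply, hφg]
    norm_num
  · rw [← hgn, map_pow, pow_mul, hg4, hn.neg_one_pow]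
  · have hx0 : x ≠ 0 := by rintro rfl; simp [MulChar.map_zero] at hx
    obtain ⟨k, hk⟩ := mem_powers_iff_mem_zpowers.2 (hg (Units.mk0 x hx0))
    have hk' : (g : F) ^ k = x := by
      simpa using congrArg Units.val hk
    rw [← hk', map_pow] at hx
    obtain ⟨l, rfl⟩ := hordψ ▸ orderOf_dvd_of_pow_eq_one hx
    exact ⟨(g : F) ^ l, pow_ne_zero _ g.ne_zero, by rw [← hk', mul_comm 8 l, pow_mul]⟩

/-- The Fourier expansion of the autocorrelation of the octic residues at `d`, evaluated by means
of the values of the Jacobi sums of an octic character `ψ` with `ψ (-1) = -1`. -/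
lemma sum_range_pow_mul_jacobiSum {F : Type*} [Field F] [Fintype F]
    {ψ : MulChar F ℂ} (hψ : ψ ^ 8 = 1) (hneg : ψ (-1) = -1) (h1 : ∀ k ∈ Icc 1 7, ψ ^ k ≠ 1)
    {α α' γ γ' : ℂ} (h11 : jacobiSum (ψ ^ 1) (ψ ^ 1) = γ) (h33 : jacobiSum (ψ ^ 3) (ψ ^ 3) = γ)
    (h14 : jacobiSum (ψ ^ 1) (ψ ^ 4) = γ) (h55 : jacobiSum (ψ ^ 5) (ψ ^ 5) = γ')
    (h77 : jacobiSum (ψ ^ 7) (ψ ^ 7) = γ') (h54 : jacobiSum (ψ ^ 5) (ψ ^ 4) = γ')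
    (h15 : jacobiSum (ψ ^ 1) (ψ ^ 5) = α) (h22 : jacobiSum (ψ ^ 2) (ψ ^ 2) = α)
    (h37 : jacobiSum (ψ ^ 3) (ψ ^ 7) = α') (h66 : jacobiSum (ψ ^ 6) (ψ ^ 6) = α')
    (hγ : γ + γ' = -2) (hα : α + α' = 6) {d : F} (hd : d ≠ 0) :
    ∑ j ∈ range 8, ∑ k ∈ range 8, ψ d ^ (j + k) * (-1) ^ k * jacobiSum (ψ ^ k) (ψ ^ j) =
      Fintype.card F - 9 := by
  classical
  have hinv (k j l : ℕ) (h : k + j + l = 8 ∨ k + j + l = 16) (hk : k ≠ 0) :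
      jacobiSum (ψ ^ k) (ψ ^ j) = (-1) ^ k * jacobiSum (ψ ^ k) (ψ ^ l) := by
    have hl : (ψ ^ k * ψ ^ j)⁻¹ = ψ ^ l := by
      apply inv_eq_of_mul_eq_one_right
      rw [← pow_add, ← pow_add]
      rcases h with h | h <;> rw [h]
      · exact hψ
      · rw [show 16 = 8 * 2 by norm_num, pow_mul, hψ, one_pow]
    rw [jacobiSum_eq_apply_neg_one_mul_jacobiSum_inv, hl, ψ.pow_apply' hk, hneg]
  have h00 : jacobiSum (ψ ^ 0) (ψ ^ 0) = (Fintype.card F - 2 : ℂ) := by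
    rw [pow_zero]; exact jacobiSum_one_one
  have h0 (k : ℕ) (hk : k ∈ Icc 1 7) : jacobiSum (ψ ^ 0) (ψ ^ k) = -1 := by
    rw [pow_zero]; exact jacobiSum_one_nontrivial (h1 k hk)
  have h8 (k : ℕ) (hk : k ∈ Icc 1 7) : jacobiSum (ψ ^ k) (ψ ^ (8 - k)) = -(-1) ^ k := by
    have h := mem_Icc.1 hk
    rw [← hneg, ← ψ.pow_apply' (by lia), ← jacobiSum_nontrivial_inv (h1 k hk)]
    congr 1
    exact (inv_eq_of_mul_eq_one_right (by rw [← pow_add, Nat.add_sub_cancel' (by lia), hψ])).symm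
  have hD : ψ d ^ 8 = 1 := by
    rw [← ψ.pow_apply' (by norm_num), hψ, MulChar.one_apply hd.isUnit]
  have hcomm (k j : ℕ) : jacobiSum (ψ ^ k) (ψ ^ j) = jacobiSum (ψ ^ j) (ψ ^ k) :=
    jacobiSum_comm _ _
  generalize hJ : (fun k j ↦ jacobiSum (ψ ^ k) (ψ ^ j)) = J
  have hJ' (k j : ℕ) : jacobiSum (ψ ^ k) (ψ ^ j) = J k j := by rw [← hJ]
  simp only [hJ'] at *
  have h12 : J 1 2 = -α := by rw [hinv 1 2 5 (by decide) (by decide), h15]; ring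
  have h13 : J 1 3 = -γ := by rw [hinv 1 3 4 (by decide) (by decide), h14]; ring
  have h16 : J 1 6 = -γ := by rw [hinv 1 6 1 (by decide) (by decide), h11]; ring
  have h32 : J 3 2 = -γ := by rw [hinv 3 2 3 (by decide) (by decide), h33]; ring
  have h24 : J 2 4 = α := by rw [hinv 2 4 2 (by decide) (by decide), h22]; ring
  have h51 : J 5 1 = α := by rw [hcomm, h15]
  have h52 : J 5 2 = -α := by rw [hinv 5 2 1 (by decide) (by decide), h51]; ring
  have h72 : J 7 2 = -γ' := by rw [hinv 7 2 7 (by decide) (by decide), h77]; ring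
  have h31 : J 3 1 = -γ := by rw [hcomm, h13]
  have h34 : J 3 4 = γ := by rw [hinv 3 4 1 (by decide) (by decide), h31]; ring
  have h36 : J 3 6 = -α' := by rw [hinv 3 6 7 (by decide) (by decide), h37]; ring
  have h64 : J 6 4 = α' := by rw [hinv 6 4 6 (by decide) (by decide), h66]; ring
  have h57 : J 5 7 = -γ' := by rw [hinv 5 7 4 (by decide) (by decide), h54]; ring
  have h75 : J 7 5 = -γ' := by rw [hcomm, h57]
  have h74 : J 7 4 = γ' := by rw [hinv 7 4 5 (by decide) (by decide), h75]; ring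
  have h56 : J 5 6 = -γ' := by rw [hinv 5 6 5 (by decide) (by decide), h55]; ring
  have h73 : J 7 3 = α' := by rw [hcomm, h37]
  have h76 : J 7 6 = -α' := by rw [hinv 7 6 3 (by decide) (by decide), h73]; ring
  have h17 : J 1 7 = 1 := by rw [h8 1 (by decide)]; norm_num
  have h26 : J 2 6 = -1 := by rw [h8 2 (by decide)]; norm_num
  have h35 : J 3 5 = 1 := by rw [h8 3 (by decide)]; norm_num
  have h44 : J 4 4 = -1 := by rw [h8 4 (by decide)]; norm_num
  have h53 : J 5 3 = 1 := by rw [h8 5 (by decide)]; norm_num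
  have h62 : J 6 2 = -1 := by rw [h8 6 (by decide)]; norm_num
  have h71 : J 7 1 = 1 := by rw [h8 7 (by decide)]; norm_num
  have h01 : J 0 1 = -1 := by exact h0 1 (by decide)
  have h02 : J 0 2 = -1 := by exact h0 2 (by decide)
  have h03 : J 0 3 = -1 := by exact h0 3 (by decide)
  have h04 : J 0 4 = -1 := by exact h0 4 (by decide)
  have h05 : J 0 5 = -1 := by exact h0 5 (by decide)
  have h06 : J 0 6 = -1 := by exact h0 6 (by decide)
  have h07 : J 0 7 = -1 := by exact h0 7 (by decide)
  have h10 : J 1 0 = -1 := by rw [hcomm, h01]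
  have h20 : J 2 0 = -1 := by rw [hcomm, h02]
  have h21 : J 2 1 = -α := by rw [hcomm, h12]
  have h23 : J 2 3 = -γ := by rw [hcomm, h32]
  have h25 : J 2 5 = -α := by rw [hcomm, h52]
  have h27 : J 2 7 = -γ' := by rw [hcomm, h72]
  have h30 : J 3 0 = -1 := by rw [hcomm, h03]
  have h40 : J 4 0 = -1 := by rw [hcomm, h04]
  have h41 : J 4 1 = γ := by rw [hcomm, h14]
  have h42 : J 4 2 = α := by rw [hcomm, h24]
  have h43 : J 4 3 = γ := by rw [hcomm, h34]
  have h45 : J 4 5 = γ' := by rw [hcomm, h54]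
  have h46 : J 4 6 = α' := by rw [hcomm, h64]
  have h47 : J 4 7 = γ' := by rw [hcomm, h74]
  have h50 : J 5 0 = -1 := by rw [hcomm, h05]
  have h60 : J 6 0 = -1 := by rw [hcomm, h06]
  have h61 : J 6 1 = -γ := by rw [hcomm, h16]
  have h63 : J 6 3 = -α' := by rw [hcomm, h36]
  have h65 : J 6 5 = -γ' := by rw [hcomm, h56]
  have h67 : J 6 7 = -α' := by rw [hcomm, h76]
  have h70 : J 7 0 = -1 := by rw [hcomm, h07]
  simp only [sum_range_succ, sum_range_zero, Nat.reduceAdd, zero_add,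
    h00, h01, h02, h03, h04, h05, h06, h07, h10, h11, h12, h13, h14, h15, h16, h17, h20, h21, h22,
    h23, h24, h25, h26, h27, h30, h31, h32, h33, h34, h35, h36, h37, h40, h41, h42, h43, h44, h45,
    h46, h47, h50, h51, h52, h53, h54, h55, h56, h57, h60, h61, h62, h63, h64, h65, h66, h67, h70,
    h71, h72, h73, h74, h75, h76, h77]
  linear_combination ψ d ^ 4 * (2 * hγ + hα) - (ψ d ^ 2 + ψ d ^ 6) * hγ +
    (-7 - ψ d ^ 2 * γ' + ψ d ^ 4 * (2 * γ' + α') - ψ d ^ 6 * γ') * hD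

lemma mul_card_filter_apply_eq_one {F : Type*} [Field F] [Fintype F] {ψ : MulChar F ℂ} {n : ℕ}
    (hψ : ψ ^ n = 1) (h1 : ∀ k ∈ Ico 1 n, ψ ^ k ≠ 1) (hn : 0 < n) :
    n * #{x | ψ x = 1} = Fintype.card F - 1 := by
  classical
  have h : (n * #{x | ψ x = 1} : ℂ) = (Fintype.card F - 1 : ℕ) := by
    calc (n * #{x | ψ x = 1} : ℂ) = ∑ x, ∑ k ∈ range n, (ψ ^ k) x := by
          simp only [sum_range_pow_apply hψ, ← sum_filter, sum_const, nsmul_eq_mul, mul_comm]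
      _ = ∑ x, (ψ ^ 0) x := by
          rw [sum_comm]
          refine sum_eq_single_of_mem 0 (mem_range.2 hn) fun k hk hk0 ↦ ?_
          rw [mem_range] at hk
          exact MulChar.sum_eq_zero_of_ne_one (h1 k (mem_Ico.2 ⟨by lia, hk⟩))
      _ = (Fintype.card F - 1 : ℕ) := by
          rw [pow_zero, MulChar.sum_one_eq_card_units, Fintype.card_units]
  exact_mod_cast h

lemma sq_mul_card_filter_apply_add_eq_one {F : Type*} [Field F] [Fintype F] {ψ : MulChar F ℂ}
    {n : ℕ} (hψ : ψ ^ n = 1) (hneg : ψ (-1) = -1) {d : F} (hd : d ≠ 0) :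
    (n ^ 2 * #{b | ψ (b + d) = 1 ∧ ψ b = 1} : ℂ) = ∑ j ∈ range n, ∑ k ∈ range n,
      ψ d ^ (j + k) * (-1) ^ k * jacobiSum (ψ ^ k) (ψ ^ j) := by
  classical
  have hpow (k : ℕ) {x : F} (hx : x ≠ 0) : (ψ ^ k) x = ψ x ^ k :=
    MulChar.pow_apply_coe ψ k (Units.mk0 x hx)
  have h (b : F) : (∑ j ∈ range n, (ψ ^ j) (b + d)) * ∑ k ∈ range n, (ψ ^ k) b =
      if ψ (b + d) = 1 ∧ ψ b = 1 then (n ^ 2 : ℂ) else 0 := by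
    rw [sum_range_pow_apply hψ, sum_range_pow_apply hψ]
    split_ifs <;> simp_all [sq]
  calc (n ^ 2 * #{b | ψ (b + d) = 1 ∧ ψ b = 1} : ℂ)
      = ∑ b, (∑ j ∈ range n, (ψ ^ j) (b + d)) * ∑ k ∈ range n, (ψ ^ k) b := by
        simp only [h, ← sum_filter, sum_const, nsmul_eq_mul, mul_comm]
    _ = ∑ j ∈ range n, ∑ k ∈ range n, ∑ b, (ψ ^ j) (b + d) * (ψ ^ k) b := by
        simp only [sum_mul_sum]
        rw [sum_comm]
        exact sum_congr rfl fun j _ ↦ sum_comm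
    _ = _ := by
        refine sum_congr rfl fun j _ ↦ sum_congr rfl fun k _ ↦ ?_
        rw [sum_apply_add_mul_apply _ _ hd, ← pow_add, hpow _ hd,
          hpow _ (neg_ne_zero.2 one_ne_zero), hneg]

/-- The Jacobi sum computations for an octic character show that the autocorrelation of the octic
residues is constant. -/
lemma mul_card_filter_apply_add_eq_one {p : ℕ} [Fact p.Prime] {t u : ℤ} (ht : Odd t)
    (hp1 : (p : ℤ) = 8 * t ^ 2 + 1) (hp2 : (p : ℤ) = 64 * u ^ 2 + 9) {ψ : MulChar (ZMod p) ℂ}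
    (hψ8 : ψ ^ 8 = 1) (hψ4 : ψ ^ 4 = quadraticMulChar (ZMod p) ℂ) (hneg : ψ (-1) = -1)
    (h1 : ∀ k ∈ Icc 1 7, ψ ^ k ≠ 1) {d : ZMod p} (hd : d ≠ 0) :
    (64 * #{b | ψ (b + d) = 1 ∧ ψ b = 1} : ℂ) = p - 9 := by
  have hp : p.Prime := Fact.out
  have hpodd : Odd p := by
    have : Odd (p : ℤ) := ⟨4 * t ^ 2, by rw [hp1]; ring⟩
    exact_mod_cast this
  have hF : ringChar (ZMod p) ≠ 2 := by
    rw [ZMod.ringChar_zmod_n]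
    rintro rfl
    exact absurd hpodd (by decide)
  have hm : Odd t.natAbs := Int.natAbs_odd.2 ht
  have hpm : p = 8 * t.natAbs ^ 2 + 1 := by
    zify
    rw [sq_abs, hp1]
  have hcard : (Fintype.card (ZMod p) : ℤ) = 8 * t ^ 2 + 1 := by rw [ZMod.card, hp1]
  have hφ (x : ZMod p) : ((quadraticChar (ZMod p) x : ℤ) : ℂ) = ψ x ^ 4 := by
    rw [← ψ.pow_apply' four_ne_zero, hψ4]; rfl
  have hm4 : ψ t.natAbs ^ 4 = 1 := by
    rw [← hφ, quadraticChar_eq_one_of_eq_eight_mul_sq_add_one hm hpm, Int.cast_one]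
  have h2m : ψ 2 ^ 3 * ψ t.natAbs ^ 2 = -1 := by
    rw [← map_pow, ← map_pow, ← map_mul, ← hneg]
    congr 1
    have : ((8 * t.natAbs ^ 2 + 1 : ℕ) : ZMod p) = 0 := by rw [← hpm, ZMod.natCast_self]
    push_cast at this
    linear_combination this
  have h22 : ψ 2 ^ 2 = 1 := by
    have h8 : ψ 2 ^ 8 = 1 := by
      rw [← ψ.pow_apply' (by norm_num), hψ8, MulChar.one_apply (Ring.two_ne_zero hF).isUnit]
    have h6 : ψ 2 ^ 6 = 1 := by
      linear_combination -ψ 2 ^ 6 * hm4 + (ψ 2 ^ 3 * ψ t.natAbs ^ 2 - 1) * h2m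
    linear_combination h8 - ψ 2 ^ 2 * h6
  have hφ2 : quadraticChar (ZMod p) 2 = 1 := by
    have : ((quadraticChar (ZMod p) 2 : ℤ) : ℂ) = 1 := by
      linear_combination hφ 2 + (ψ 2 ^ 2 + 1) * h22
    exact_mod_cast this
  have h4 (k : ℕ) (hk : k ≠ 0) : (ψ ^ k) 4 = 1 := by
    rw [ψ.pow_apply' hk, show (4 : ZMod p) = 2 ^ 2 by norm_num, map_pow, h22, one_pow]
  have hred (k l : ℕ) : ψ ^ (8 * k + l) = ψ ^ l := by
    rw [pow_add, pow_mul, hψ8, one_pow, one_mul]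
  have hself (k : ℕ) (hk : k ∈ Icc 1 7) :
      jacobiSum (ψ ^ k) (ψ ^ k) = jacobiSum (ψ ^ k) (quadraticMulChar (ZMod p) ℂ) := by
    rw [← apply_four_mul_jacobiSum_self hF (h1 k hk), h4 k (by rw [mem_Icc] at hk; lia), one_mul]
  have hHD (k : ℕ) (hk : k = 1 ∨ k = 3) : jacobiSum (ψ ^ k) (ψ ^ (k + 4)) =
      jacobiSum (ψ ^ (2 * k)) (quadraticMulChar (ZMod p) ℂ) := by
    have h := apply_four_mul_jacobiSum_mul_quadraticMulChar hF (ψ := ψ ^ k)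
      (by rw [ZMod.card]; exact_mod_cast hp.ne_zero) (ZMod.isPrimitive_stdAddChar p)
    simp only [← hψ4, ← pow_mul, ← pow_add] at h
    rw [h4 k (by lia), one_mul, mul_comm k 2, hψ4] at h
    refine h (h1 _ ?_) ?_ (h1 _ ?_)
    · rcases hk with rfl | rfl <;> decide
    · rcases hk with rfl | rfl
      · exact h1 6 (by decide)
      · exact (hred 1 2).trans_ne (h1 2 (by decide))
    · rcases hk with rfl | rfl <;> decide
  obtain ⟨c, e, hc, hce, hc4⟩ :=
    exists_jacobiSum_quadratic_of_pow_four_eq hF ht.pow hcard hψ4 hneg hφ2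
  obtain ⟨a, b, ha, hab, ha4⟩ := exists_jacobiSum_quadratic_of_sq_eq hF hcard (χ := ψ ^ 2)
    (by rw [← pow_mul, hψ4]) (by rw [ψ.pow_apply' two_ne_zero, hneg]; norm_num) hφ2
  rw [ZMod.card] at hce hab
  have hc1 : c = -1 := by
    have h := sq_eq_sq_of_sq_add_two_mul_sq_eq_prime hp hce (z := 1) (w := 2 * t)
      (by rw [hp1]; ring)
    rcases sq_eq_sq_iff_eq_or_eq_neg.1 h with rfl | rfl
    · exact absurd hc4 (by decide)
    · rfl
  have ha3 : a = 3 := by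
    have haodd : Odd a := by
      obtain ⟨k, hk⟩ := ha4.dvd
      exact ⟨-2 * k - 1, by linarith⟩
    have h := sq_eq_sq_of_sq_add_sq_eq_prime hp haodd (z := 3) (w := 8 * u) (by decide) hpodd hab
      (by rw [hp2]; ring)
    rcases sq_eq_sq_iff_eq_or_eq_neg.1 h with rfl | rfl
    · rfl
    · exact absurd ha4 (by decide)
  have h3 := jacobiSum_pow_three_quadratic hψ4 hneg
  have h7 := jacobiSum_pow_three_quadratic (ψ := ψ ^ 5)
    (by rw [← pow_mul, ← hψ4]; exact hred 2 4)
    (by rw [ψ.pow_apply' (by norm_num), hneg]; norm_num)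
  rw [← pow_mul, show ψ ^ (5 * 3) = ψ ^ 7 from hred 1 7] at h7
  have hsum := sum_range_pow_mul_jacobiSum hψ8 hneg h1
    (by rw [hself 1 (by decide), pow_one]) (by rw [hself 3 (by decide), h3])
    (by rw [pow_one, hψ4]) (hself 5 (by decide)) (by rw [hself 7 (by decide), h7])
    (by rw [hψ4]) (hHD 1 (by decide)) (hself 2 (by decide)) (hHD 3 (by decide))
    (hself 6 (by decide)) (by rw [hc, hc1]; norm_num)
    (by rw [show ψ ^ 6 = (ψ ^ 2) ^ 3 by rw [← pow_mul], ha, ha3]; norm_num) hd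
  rw [← sq_mul_card_filter_apply_add_eq_one hψ8 hneg hd, ZMod.card] at hsum
  rw [← hsum]
  norm_num

end

/-- For odd integers `t`, `u` with `p = 8t² + 1 = 64u² + 9` prime, the nonzero
eighth powers form a cyclic difference set `DS(p, (p−1)/8, (p−9)/64)` in
`ℤ/pℤ`. -/
theorem octic_residues_difference_set (t u : ℤ) (p : ℕ) (ht : Odd t) (hu : Odd u)
    (hp1 : (p : ℤ) = 8 * t ^ 2 + 1) (hp2 : (p : ℤ) = 64 * u ^ 2 + 9)
    [Fact p.Prime] :
    let B : Finset (ZMod p) :=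
      (Finset.univ.filter (fun x : ZMod p => x ≠ 0)).image (fun x => x ^ 8)
    B.card = (p - 1) / 8 ∧
    ∀ d : ZMod p, d ≠ 0 →
      ((B ×ˢ B).filter (fun q => q.1 ≠ q.2 ∧ q.1 - q.2 = d)).card = (p - 9) / 64 := by
  intro B
  have hcard : Fintype.card (ZMod p) = 8 * t.natAbs ^ 2 + 1 := by
    rw [ZMod.card]
    zify
    rw [sq_abs, hp1]
  obtain ⟨ψ, hord, hψ4, hneg, hψ⟩ := exists_mulChar_pow_four_eq_quadratic (ZMod p)
    (Int.natAbs_odd.2 ht).pow hcard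
  have hψ8 : ψ ^ 8 = 1 := hord ▸ pow_orderOf_eq_one ψ
  have h1 (k : ℕ) (hk : k ∈ Finset.Icc 1 7) : ψ ^ k ≠ 1 := by
    rw [Finset.mem_Icc] at hk
    exact pow_ne_one_of_lt_orderOf (by lia) (by lia)
  have hB (x : ZMod p) : x ∈ B ↔ ψ x = 1 := by
    simp only [B, Finset.mem_image, Finset.mem_filter, Finset.mem_univ, true_and]
    refine ⟨?_, fun hx ↦ hψ x hx⟩
    rintro ⟨y, hy, rfl⟩
    rw [map_pow, ← ψ.pow_apply' (by norm_num), hψ8, MulChar.one_apply hy.isUnit]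
  refine ⟨?_, fun d hd ↦ ?_⟩
  · have h := mul_card_filter_apply_eq_one hψ8 h1 (by norm_num)
    rw [ZMod.card, ← Finset.filter_congr fun x _ ↦ hB x, Finset.filter_univ_mem] at h
    lia
  · have h := mul_card_filter_apply_add_eq_one ht hp1 hp2 hψ8 hψ4 hneg h1 hd
    have h64 : 64 * (Finset.univ.filter fun b ↦ ψ (b + d) = 1 ∧ ψ b = 1).card + 9 = p := by
      have : (64 * (Finset.univ.filter fun b ↦ ψ (b + d) = 1 ∧ ψ b = 1).card + 9 : ℂ) = p := by
        rw [h]; ring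
      exact_mod_cast this
    have hN : ((B ×ˢ B).filter (fun q ↦ q.1 ≠ q.2 ∧ q.1 - q.2 = d)).card =
        (Finset.univ.filter fun b ↦ ψ (b + d) = 1 ∧ ψ b = 1).card := by
      refine Finset.card_nbij' (fun q ↦ q.2) (fun b ↦ (b + d, b)) ?_ ?_ ?_ ?_
      · rintro ⟨a, b⟩ hq
        simp only [Finset.coe_filter, Finset.mem_product, hB, Set.mem_ofPred_eq] at hq
        obtain ⟨⟨ha, hb⟩, -, rfl⟩ := hq
        simp [ha, hb]
      · intro b hb
        simp only [Finset.coe_filter, Finset.mem_univ, true_and, Set.mem_ofPred_eq] at hb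
        simp [hB, hb, hd]
      · rintro ⟨a, b⟩ hq
        simp only [Finset.coe_filter, Set.mem_ofPred_eq] at hq
        simp [← hq.2.2]
      · intro b _
        rfl
    rw [hN]
    lia
end
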